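/- arXiv:2112.03366 — 2 statements merged into one kernel-verified Lean document; each statement's English description precedes it below -/
import Mathlib

section
/- Let n ≥ 7 and let G and H be simple graphs on n vertices that share n−1 cards. If κ_r(G) ≠ κ_r(H) for some integer r ≥ 1, then the set of vertices of maximum degree of G, { v ∈ V(G) : deg(v,G) = Δ(G) }, is a clique in G, and moreover r = n − ℓ(G). -/
open SimpleGraph

/-- `kappa G r` is the number of `r`-cliques of the graph `G`. -/
noncomputable def kappa {V : Type*} (G : SimpleGraph V) (r : ℕ) : ℕ :=
  (G.cliqueSet r).ncard

/-- `degR G r v` is the number of `r`-cliques of `G` that contain the vertex `v`. -/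
noncomputable def degR {V : Type*} (G : SimpleGraph V) (r : ℕ) (v : V) : ℕ :=
  {s | s ∈ G.cliqueSet r ∧ v ∈ s}.ncard

/-- `deg G v` is the degree of the vertex `v` in `G`. -/
noncomputable def deg {V : Type*} (G : SimpleGraph V) (v : V) : ℕ :=
  (G.neighborSet v).ncard

/-- `gcard G v` is the card `G - v`: the induced subgraph of `G` on `V(G) \ {v}`. -/
def gcard {V : Type*} (G : SimpleGraph V) (v : V) : SimpleGraph {x : V // x ≠ v} :=
  G.induce {x : V | x ≠ v}

/-- The maximum degree `Δ(G)`. -/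
noncomputable def maxDeg {n : ℕ} (G : SimpleGraph (Fin n)) : ℕ :=
  Finset.univ.sup (fun v => deg G v)

/-- The minimum degree `δ(G)`. -/
noncomputable def minDeg {n : ℕ} (G : SimpleGraph (Fin n)) : ℕ :=
  sInf (Set.range (fun v => deg G v))

/-- `ℓ(G)`: the number of vertices of maximum degree. -/
noncomputable def numMaxDeg {n : ℕ} (G : SimpleGraph (Fin n)) : ℕ :=
  (Finset.univ.filter (fun v => deg G v = maxDeg G)).card

/-- `G` and `H` share `n-1` cards via the vertices `u`, `w` and the bijection `π`:
for every `v ≠ u`, the card `G - v` is isomorphic to the card `H - π(v)`. -/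
def ShareCardsVia {n : ℕ} (G H : SimpleGraph (Fin n)) (u w : Fin n)
    (π : {x : Fin n // x ≠ u} ≃ {y : Fin n // y ≠ w}) : Prop :=
  ∀ v : {x : Fin n // x ≠ u}, Nonempty (gcard G v.1 ≃g gcard H (π v).1)

/-- `G` and `H` share `n-1` cards. -/
def ShareCards {n : ℕ} (G H : SimpleGraph (Fin n)) : Prop :=
  ∃ (u w : Fin n) (π : {x : Fin n // x ≠ u} ≃ {y : Fin n // y ≠ w}),
    ShareCardsVia G H u w π


namespace MDC
open Finset
open scoped Classical
set_option linter.unusedSectionVars false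

section basics
variable {V : Type*} [Fintype V]

/-- The card isomorphism at `v`, extended to a permutation fixing `v`. -/
def CIso (G H : SimpleGraph V) (v : V) (φ : V ≃ V) : Prop :=
  φ v = v ∧ ∀ a b, a ≠ v → b ≠ v → (G.Adj a b ↔ H.Adj (φ a) (φ b))

/-- All cards except the one at `u` agree. -/
def Sh (G H : SimpleGraph V) (u : V) : Prop := ∀ v, v ≠ u → ∃ φ, CIso G H v φ

noncomputable def cl (G : SimpleGraph V) (r : ℕ) : Finset (Finset V) :=
  univ.filter (fun s => G.IsNClique r s)

noncomputable def K (G : SimpleGraph V) (r : ℕ) : ℤ := ((cl G r).card : ℤ)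

noncomputable def D (G : SimpleGraph V) (r : ℕ) (v : V) : ℤ :=
  (((cl G r).filter (fun s => v ∈ s)).card : ℤ)

noncomputable def dg (G : SimpleGraph V) (v : V) : ℕ := (univ.filter (fun b => G.Adj v b)).card

/-- degree of `a` in `G - v` -/
noncomputable def cdg (G : SimpleGraph V) (v a : V) : ℕ :=
  (univ.filter (fun b => b ≠ v ∧ G.Adj a b)).card

lemma CIso.symm {G H : SimpleGraph V} {v : V} {φ : V ≃ V} (h : CIso G H v φ) :
    CIso H G v φ.symm := by
  obtain ⟨h1, h2⟩ := h
  have h3 : φ.symm v = v := by rw [Equiv.symm_apply_eq]; exact h1.symm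
  refine ⟨h3, fun a b ha hb => ?_⟩
  have := h2 (φ.symm a) (φ.symm b) (fun h => ha (by rw [Equiv.symm_apply_eq] at h; rw [h, h1]))
    (fun h => hb (by rw [Equiv.symm_apply_eq] at h; rw [h, h1]))
  simpa using this.symm

lemma CIso.ne {G H : SimpleGraph V} {v : V} {φ : V ≃ V} (h : CIso G H v φ) {a : V} :
    φ a ≠ v ↔ a ≠ v := by
  have := h.1
  constructor
  · rintro h1 rfl; exact h1 this
  · intro h1 h2; exact h1 (φ.injective (h2.trans this.symm))

lemma Sh.symm {G H : SimpleGraph V} {u : V} (h : Sh G H u) : Sh H G u := fun v hv => by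
  obtain ⟨φ, hφ⟩ := h v hv
  exact ⟨φ.symm, hφ.symm⟩

lemma Sh.compl {G H : SimpleGraph V} {u : V} (h : Sh G H u) : Sh Gᶜ Hᶜ u := fun v hv => by
  obtain ⟨φ, hφ⟩ := h v hv
  refine ⟨φ, hφ.1, fun a b ha hb => ?_⟩
  simp only [SimpleGraph.compl_adj, hφ.2 a b ha hb, ne_eq, φ.injective.eq_iff]

lemma CIso.clique {G H : SimpleGraph V} {v : V} {φ : V ≃ V} (h : CIso G H v φ) (r : ℕ)
    (s : Finset V) (hs : v ∉ s) :
    G.IsNClique r s ↔ H.IsNClique r (s.map φ.toEmbedding) := by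
  simp only [SimpleGraph.isNClique_iff, card_map, SimpleGraph.isClique_iff, Set.Pairwise]
  refine and_congr ?_ Iff.rfl
  simp only [mem_coe, mem_map_equiv]
  constructor
  · intro h1 a ha b hb hab
    have := h1 ha hb (by simpa using hab)
    rw [h.2 _ _ (by rintro h; rw [h] at ha; exact hs ha) (by rintro h; rw [h] at hb; exact hs hb)] at this
    simpa using this
  · intro h1 a ha b hb hab
    rw [h.2 _ _ (by rintro rfl; exact hs ha) (by rintro rfl; exact hs hb)]
    exact h1 (by simpa using ha) (by simpa using hb) (by simpa using hab)

lemma CIso.count {G H : SimpleGraph V} {v : V} {φ : V ≃ V} (h : CIso G H v φ) (r : ℕ)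
    (P : Finset V → Prop) :
    ((cl G r).filter (fun s => v ∉ s ∧ P (s.map φ.toEmbedding))).card =
      ((cl H r).filter (fun s => v ∉ s ∧ P s)).card := by
  apply Finset.card_equiv φ.finsetCongr
  intro s
  have hv : φ.symm v = v := h.symm.1
  simp only [cl, mem_filter, mem_univ, true_and, Equiv.finsetCongr_apply, mem_map_equiv, hv]
  constructor
  · rintro ⟨h1, h2, h3⟩; exact ⟨(h.clique r s h2).1 h1, h2, h3⟩
  · rintro ⟨h1, h2, h3⟩; exact ⟨(h.clique r s h2).2 h1, h2, h3⟩

lemma K_split (G : SimpleGraph V) (r : ℕ) (v : V) :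
    K G r = D G r v + (((cl G r).filter (fun s => v ∉ s)).card : ℤ) := by
  unfold K D
  rw [← Finset.card_filter_add_card_filter_not (s := cl G r) (fun s => v ∈ s)]
  push_cast; rfl

lemma CIso.K_sub {G H : SimpleGraph V} {v : V} {φ : V ≃ V} (h : CIso G H v φ) (r : ℕ) :
    D G r v - D H r v = K G r - K H r := by
  have := h.count r (fun _ => True)
  simp only [and_true] at this
  rw [K_split G r v, K_split H r v, this]; ring

lemma sum_D (G : SimpleGraph V) (r : ℕ) : ∑ v, D G r v = r * K G r := by
  unfold D K
  have : ∀ v, (((cl G r).filter (fun s => v ∈ s)).card : ℤ)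
      = ∑ s ∈ cl G r, if v ∈ s then 1 else 0 := by
    intro v; simp
  simp only [this]
  rw [Finset.sum_comm]
  have : ∀ s ∈ cl G r, (∑ v : V, if v ∈ s then (1:ℤ) else 0) = r := by
    intro s hs
    simp only [cl, mem_filter, SimpleGraph.isNClique_iff] at hs
    simp [hs.2.2]
  rw [Finset.sum_congr rfl this]
  simp [mul_comm]

lemma D_u {G H : SimpleGraph V} {u : V} (h : Sh G H u) (r : ℕ) :
    D H r u - D G r u = (Fintype.card V - 1 - r) * (K G r - K H r) := by
  have h1 := sum_D G r
  have h2 := sum_D H r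
  rw [← Finset.add_sum_erase _ _ (mem_univ u)] at h1 h2
  have h3 : ∑ v ∈ univ.erase u, D G r v - ∑ v ∈ univ.erase u, D H r v
      = (Fintype.card V - 1) * (K G r - K H r) := by
    rw [← Finset.sum_sub_distrib, Finset.sum_congr rfl (g := fun _ => K G r - K H r)]
    · have : 0 < Fintype.card V := Fintype.card_pos_iff.2 ⟨u⟩
      simp [Finset.card_erase_of_mem, Nat.cast_sub this]; ring
    · intro v hv
      obtain ⟨φ, hφ⟩ := h v (ne_of_mem_erase hv)
      exact hφ.K_sub r
  linear_combination -h1 + h2 + h3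

lemma CIso.D_eq {G H : SimpleGraph V} {v : V} {φ : V ≃ V} (h : CIso G H v φ) (r : ℕ) {x : V}
    (hx : x ≠ v) (h1 : ¬ G.Adj v x) (h2 : ¬ H.Adj v (φ x)) : D G r x = D H r (φ x) := by
  have := h.count r (fun s => φ x ∈ s)
  have e : ∀ (G : SimpleGraph V) (x : V), x ≠ v → ¬ G.Adj v x → 
      (cl G r).filter (fun s => x ∈ s) = (cl G r).filter (fun s => v ∉ s ∧ x ∈ s) := by
    intro G x hx hn
    apply Finset.filter_congr
    intro s hs
    simp only [cl, mem_filter, SimpleGraph.isNClique_iff, SimpleGraph.isClique_iff] at hs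
    refine ⟨fun h => ⟨fun hv => hn ?_, h⟩, fun h => h.2⟩
    exact hs.2.1 hv h (Ne.symm hx)
  unfold D
  rw [e G x hx h1, e H (φ x) (h.ne.2 hx) h2]
  simp only [mem_map_equiv, Equiv.symm_apply_apply] at this
  norm_cast
  convert this

lemma D_succ (G : SimpleGraph V) (r : ℕ) (x : V) :
    D G (r+1) x = (((cl G r).filter (fun s => x ∉ s ∧ ∀ b ∈ s, G.Adj x b)).card : ℤ) := by
  unfold D
  norm_cast
  refine Finset.card_bij' (fun s _ => s.erase x) (fun s _ => insert x s) ?_ ?_ ?_ ?_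
  · intro s hs
    simp only [cl, mem_filter, mem_univ, true_and, SimpleGraph.isNClique_iff,
      SimpleGraph.isClique_iff] at hs ⊢
    obtain ⟨⟨h1, h2⟩, h3⟩ := hs
    refine ⟨⟨h1.mono (by simp), ?_⟩, by simp, ?_⟩
    · rw [card_erase_of_mem h3, h2]; rfl
    · intro b hb
      exact h1 h3 (mem_of_mem_erase hb) (ne_of_mem_erase hb).symm
  · intro s hs
    simp only [cl, mem_filter, mem_univ, true_and] at hs ⊢
    exact ⟨hs.1.insert hs.2.2, by simp⟩
  · intro s hs
    simp only [mem_filter] at hs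
    exact insert_erase hs.2
  · intro s hs
    simp only [mem_filter] at hs
    exact erase_insert hs.2.1

lemma CIso.cdg_eq {G H : SimpleGraph V} {v : V} {φ : V ≃ V} (h : CIso G H v φ) {a : V}
    (ha : a ≠ v) : cdg G v a = cdg H v (φ a) := by
  unfold cdg
  apply Finset.card_equiv φ
  intro b
  simp only [mem_filter, mem_univ, true_and, h.ne]
  exact and_congr_right fun hb => h.2 a b ha hb

lemma cdg_add (G : SimpleGraph V) (v a : V) :
    cdg G v a + (if G.Adj v a then 1 else 0) = dg G a := by
  unfold cdg dg
  by_cases h : G.Adj v a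
  · have : univ.filter (fun b => G.Adj a b) = insert v (univ.filter (fun b => b ≠ v ∧ G.Adj a b)) := by
      ext b; simp only [mem_filter, mem_univ, true_and, mem_insert]
      by_cases hb : b = v
      · subst hb; simp [h.symm]
      · simp [hb]
    rw [this, card_insert_of_notMem (by simp)]
    simp [h]
  · simp only [h, if_false, add_zero]
    congr 1
    ext b; simp only [mem_filter, mem_univ, true_and, and_iff_right_iff_imp]
    rintro hb rfl; exact h hb.symm

lemma dg_compl (G : SimpleGraph V) (v : V) : dg Gᶜ v + dg G v + 1 = Fintype.card V := by
  have h := Finset.card_filter_add_card_filter_not (s := univ.erase v) (fun b => G.Adj v b)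
  rw [card_erase_of_mem (mem_univ v), card_univ] at h
  have : 0 < Fintype.card V := Fintype.card_pos_iff.2 ⟨v⟩
  have e1 : (univ.erase v).filter (fun b => G.Adj v b) = univ.filter (fun b => G.Adj v b) := by
    ext b; simp only [mem_filter, mem_erase, mem_univ, and_true, true_and, and_iff_right_iff_imp]
    intro h; exact h.ne'
  have e2 : (univ.erase v).filter (fun b => ¬ G.Adj v b) = univ.filter (fun b => Gᶜ.Adj v b) := by
    ext b; simp only [mem_filter, mem_erase, mem_univ, and_true, true_and, SimpleGraph.compl_adj,
      ne_comm]
  rw [e1, e2] at h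
  have e3 : dg Gᶜ v + dg G v = Fintype.card V - 1 := by
    rw [← h, add_comm]; unfold dg; congr!
  omega

/-- degree differences -/
lemma dg_diff {G H : SimpleGraph V} {u : V} (hV : 2 ≤ Fintype.card V) (h : Sh G H u) :
    ∃ k : ℤ, (∀ v, v ≠ u → (dg G v : ℤ) - dg H v = k) ∧
      (dg H u : ℤ) - dg G u = (Fintype.card V - 3) * k := by
  have S : ∀ (G : SimpleGraph V) (v : V), ∑ a ∈ univ.erase v, (cdg G v a : ℤ)
      = ∑ a, (dg G a : ℤ) - 2 * dg G v := by
    intro G v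
    rw [← Finset.add_sum_erase _ (fun a => (dg G a : ℤ)) (mem_univ v)]
    have : ∀ a, (dg G a : ℤ) = cdg G v a + (if G.Adj v a then 1 else 0) := by
      intro a; rw [← cdg_add G v a]; push_cast; rfl
    rw [Finset.sum_congr rfl (fun a _ => this a), Finset.sum_add_distrib]
    have : ∑ a ∈ univ.erase v, (if G.Adj v a then (1:ℤ) else 0) = dg G v := by
      rw [Finset.sum_erase _ (by simp)]
      simp [dg]
    rw [this]; ring
  have S2 : ∀ v, v ≠ u → 2 * ((dg G v : ℤ) - dg H v) = ∑ a, (dg G a : ℤ) - ∑ a, (dg H a : ℤ) := by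
    intro v hv
    obtain ⟨φ, hφ⟩ := h v hv
    have : ∑ a ∈ univ.erase v, (cdg G v a : ℤ) = ∑ a ∈ univ.erase v, (cdg H v a : ℤ) := by
      apply Finset.sum_equiv φ
      · intro i; simp [hφ.ne]
      · intro i hi; rw [hφ.cdg_eq (ne_of_mem_erase hi)]
    rw [S, S] at this
    linarith
  obtain ⟨v0, hv0⟩ : ∃ v, v ≠ u := Fintype.exists_ne_of_one_lt_card hV u
  refine ⟨(dg G v0 : ℤ) - dg H v0, fun v hv => ?_, ?_⟩
  · have := S2 v hv; have := S2 v0 hv0; omega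
  · have h0 := S2 v0 hv0
    rw [← Finset.add_sum_erase _ (fun a => (dg G a : ℤ)) (mem_univ u),
      ← Finset.add_sum_erase _ (fun a => (dg H a : ℤ)) (mem_univ u)] at h0
    have h3 : ∑ v ∈ univ.erase u, (dg G v : ℤ) - ∑ v ∈ univ.erase u, (dg H v : ℤ)
      = (Fintype.card V - 1) * ((dg G v0 : ℤ) - dg H v0) := by
      rw [← Finset.sum_sub_distrib, Finset.sum_congr rfl (g := fun _ => (dg G v0 : ℤ) - dg H v0)]
      · have : 0 < Fintype.card V := Fintype.card_pos_iff.2 ⟨u⟩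
        simp [Finset.card_erase_of_mem, Nat.cast_sub this]; ring
      · intro v hv
        have := S2 v (ne_of_mem_erase hv); have := S2 v0 hv0; omega
    linear_combination h3 + h0

end basics

section myrvold
variable {V : Type*} [Fintype V]

lemma avoid (S : Finset V) (h : S.card < Fintype.card V) : ∃ v, v ∉ S := by
  by_contra! hc
  have : S = univ := by ext; simp [hc]
  rw [this, card_univ] at h; omega

lemma dg_zero {G : SimpleGraph V} {a : V} (h : dg G a = 0) (b : V) : ¬ G.Adj a b := by
  intro hb
  rw [dg, card_eq_zero] at h
  have : b ∈ univ.filter (fun b => G.Adj a b) := by simp [hb]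
  rw [h] at this; simp at this

lemma dg_le_one {G : SimpleGraph V} {a : V} (h : dg G a ≤ 1) {b c : V} (hb : G.Adj a b)
    (hc : G.Adj a c) : b = c := by
  rw [dg, card_le_one] at h
  exact h b (by simp [hb]) c (by simp [hc])

lemma cdg_zero {G : SimpleGraph V} {v a : V} : cdg G v a = 0 ↔ ∀ b, G.Adj a b → b = v := by
  rw [cdg, card_eq_zero, filter_eq_empty_iff]
  simp only [mem_univ, true_implies, not_and', ne_eq, not_not]

lemma cdg_le_one {G : SimpleGraph V} {v a : V} (h : cdg G v a ≤ 1) {b c : V} (hb : G.Adj a b)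
    (hc : G.Adj a c) (hbv : b ≠ v) (hcv : c ≠ v) : b = c := by
  rw [cdg, card_le_one] at h
  exact h b (by simp [hb, hbv]) c (by simp [hc, hcv])

lemma cdg_le (G : SimpleGraph V) (v a : V) : cdg G v a ≤ dg G a := by
  rw [← cdg_add G v a]; omega

lemma dg_le_cdg (G : SimpleGraph V) (v a : V) : dg G a ≤ cdg G v a + 1 := by
  rw [← cdg_add G v a]; split_ifs <;> omega

lemma cdg_nadj {G : SimpleGraph V} {v a : V} (h : ¬ G.Adj v a) : cdg G v a = dg G a := by
  rw [← cdg_add G v a]; simp [h]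

lemma dg_pos {G : SimpleGraph V} {a b : V} (h : G.Adj a b) : 1 ≤ dg G a := by
  by_contra hc
  exact dg_zero (by omega) b h

lemma CIso.cdg_symm {G H : SimpleGraph V} {v : V} {φ : V ≃ V} (h : CIso G H v φ) {a : V}
    (ha : a ≠ v) : cdg G v (φ.symm a) = cdg H v a := (h.symm.cdg_eq ha).symm

lemma g_zero {G H : SimpleGraph V} {u : V} (hn : 7 ≤ Fintype.card V) (h : Sh G H u)
    (hd : ∀ v, v ≠ u → dg G v = dg H v + 1) (hu : dg G u = 0)
    (hw : dg H u + 3 = Fintype.card V) : False := by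
  have s1 : ∀ y, y ≠ u → ∃ z, z ≠ u ∧ ¬ H.Adj u z ∧ z ≠ y ∧ ∀ b, H.Adj z b → b = y := by
    intro y hy
    obtain ⟨φ, hφ⟩ := h y hy
    have e := hφ.cdg_eq (Ne.symm hy)
    have e0 : cdg G y u = 0 := by have := cdg_le G y u; omega
    rw [e0] at e
    have e1 := cdg_zero.1 e.symm
    refine ⟨φ u, ?_, ?_, hφ.ne.2 (Ne.symm hy), e1⟩
    · intro h1
      rw [h1] at e
      have := dg_le_cdg H y u
      omega
    · intro h1
      exact hy (e1 u h1.symm).symm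
  have hc := dg_compl H u
  obtain ⟨z1, z2, hz, hZ⟩ := Finset.card_eq_two.1 (show dg Hᶜ u = 2 by omega)
  have hZ0 : ∀ b, Hᶜ.Adj u b ↔ b = z1 ∨ b = z2 := by
    intro b
    have := Finset.ext_iff.1 hZ b
    simpa only [mem_filter, mem_univ, true_and, mem_insert, mem_singleton] using this
  have hZ' : ∀ z, z ≠ u → ¬ H.Adj u z → z = z1 ∨ z = z2 := by
    intro z h1 h2
    exact (hZ0 z).1 ((SimpleGraph.compl_adj _ _ _).2 ⟨h1.symm, h2⟩)
  have hz1 : z1 ≠ u := ((hZ0 z1).2 (Or.inl rfl)).ne'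
  have hz2 : z2 ≠ u := ((hZ0 z2).2 (Or.inr rfl)).ne'
  have iso : (∀ b, ¬ H.Adj z1 b) ∧ (∀ b, ¬ H.Adj z2 b) := by
    by_cases i1 : ∀ b, ¬ H.Adj z1 b
    · refine ⟨i1, fun b hb => ?_⟩
      obtain ⟨z, q1, q2, q3, q4⟩ := s1 z1 hz1
      rcases hZ' z q1 q2 with rfl | rfl
      · exact q3 rfl
      · have := q4 b hb; subst this; exact i1 _ hb.symm
    · by_cases i2 : ∀ b, ¬ H.Adj z2 b
      · exfalso
        apply i1
        intro b hb
        obtain ⟨z, q1, q2, q3, q4⟩ := s1 z2 hz2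
        rcases hZ' z q1 q2 with rfl | rfl
        · have := q4 b hb; subst this; exact i2 _ hb.symm
        · exact q3 rfl
      · exfalso
        push Not at i1 i2
        obtain ⟨b1, hb1⟩ := i1
        obtain ⟨b2, hb2⟩ := i2
        obtain ⟨y, hy⟩ := avoid {u, b1, b2} (lt_of_le_of_lt card_le_three (by omega))
        simp only [mem_insert, mem_singleton, not_or] at hy
        obtain ⟨z, q1, q2, q3, q4⟩ := s1 y hy.1
        rcases hZ' z q1 q2 with rfl | rfl
        · exact hy.2.1 (q4 _ hb1).symm
        · exact hy.2.2 (q4 _ hb2).symm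
  have s5 : ∀ y, y ≠ u → y ≠ z1 → y ≠ z2 → ∃ t, t ≠ u ∧ t ≠ y ∧ G.Adj t y ∧ ∀ b, G.Adj t b → b = y := by
    intro y hy hy1 hy2
    obtain ⟨φ, hφ⟩ := h y hy
    have key : ∀ z, (∀ b, ¬ H.Adj z b) → y ≠ z → φ.symm z ≠ u → 
        ∃ t, t ≠ u ∧ t ≠ y ∧ G.Adj t y ∧ ∀ b, G.Adj t b → b = y := by
      intro z hz hyz hne
      have e := hφ.cdg_symm (Ne.symm hyz)
      have e0 : cdg H y z = 0 := cdg_zero.2 fun b hb => absurd hb (hz b)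
      have e1 := cdg_zero.1 (e.trans e0)
      refine ⟨φ.symm z, hne, hφ.symm.ne.2 (Ne.symm hyz), ?_, e1⟩
      by_contra hc
      have := cdg_nadj (fun hh => hc (SimpleGraph.Adj.symm hh) : ¬ G.Adj y (φ.symm z))
      have := hd _ hne
      omega
    by_cases h1 : φ.symm z1 = u
    · refine key z2 iso.2 hy2 ?_
      rintro h2
      exact hz (φ.symm.injective (h1.trans h2.symm))
    · exact key z1 iso.1 hy1 h1
  obtain ⟨x, hx, hxd⟩ : ∃ x, x ≠ u ∧ Fintype.card V ≤ dg G x + 4 := by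
    obtain ⟨φ, hφ⟩ := h z1 hz1
    have e := hφ.cdg_symm (Ne.symm hz1)
    have := cdg_le G z1 (φ.symm u)
    have := dg_le_cdg H z1 u
    refine ⟨φ.symm u, ?_, by omega⟩
    intro hh; rw [hh] at e
    have := cdg_le G z1 u
    omega
  choose! t t1 t2 t3 t4 using s5
  let S : Finset V := univ \ {u, z1, z2, x}
  have hS : Fintype.card V ≤ S.card + 4 := by
    have := Finset.le_card_sdiff ({u, z1, z2, x} : Finset V) univ
    have h4 : ({u, z1, z2, x} : Finset V).card ≤ 4 := card_le_four
    rw [card_univ] at this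
    change Fintype.card V ≤ (univ \ {u, z1, z2, x}).card + 4
    omega
  have hSm : ∀ y, y ∈ S ↔ y ≠ u ∧ y ≠ z1 ∧ y ≠ z2 ∧ y ≠ x := by
    intro y; simp [S]
  have inj : (S.image t).card = S.card := by
    apply card_image_of_injOn
    intro a ha b hb hab
    have ha' := (hSm a).1 ha
    have hb' := (hSm b).1 hb
    apply t4 b hb'.1 hb'.2.1 hb'.2.2.1
    rw [← hab]; exact t3 a ha'.1 ha'.2.1 ha'.2.2.1
  have sub : insert u (S.image t) ⊆ univ.filter (fun b => Gᶜ.Adj x b) := by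
    intro b hb
    rw [mem_insert, mem_image] at hb
    simp only [mem_filter, mem_univ, true_and, SimpleGraph.compl_adj]
    rcases hb with rfl | ⟨y, hy, rfl⟩
    · exact ⟨hx, fun hh => dg_zero hu x hh.symm⟩
    · have hy' := (hSm y).1 hy
      have q := t4 y hy'.1 hy'.2.1 hy'.2.2.1
      refine ⟨?_, fun hh => hy'.2.2.2 (q x hh.symm).symm⟩
      intro hxt
      rw [← hxt] at q
      have := cdg_zero.2 q
      have := dg_le_cdg G y x
      omega
  have c1 := card_le_card sub
  rw [card_insert_of_notMem, inj] at c1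
  · have c2 : (univ.filter (fun b => Gᶜ.Adj x b)).card = dg Gᶜ x := by unfold dg; congr!
    have := dg_compl G x
    omega
  · rw [mem_image]
    rintro ⟨y, hy, he⟩
    have hy' := (hSm y).1 hy
    exact t1 y hy'.1 hy'.2.1 hy'.2.2.1 he

lemma g_one {G H : SimpleGraph V} {u : V} (hn : 7 ≤ Fintype.card V) (h : Sh G H u)
    (hd : ∀ v, v ≠ u → dg G v = dg H v + 1) (hu : dg G u = 1)
    (hw : dg H u + 2 = Fintype.card V) : False := by
  obtain ⟨x0, hx0⟩ := Finset.card_eq_one.1 hu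
  have hux0 : G.Adj u x0 := by
    have : x0 ∈ univ.filter (fun b => G.Adj u b) := by rw [hx0]; simp
    simpa using this
  have hx0u : x0 ≠ u := hux0.ne'
  have hux : ∀ b, G.Adj u b → b = x0 := fun b hb => dg_le_one hu.le hb hux0
  have hc := dg_compl H u
  obtain ⟨z, hz⟩ := Finset.card_eq_one.1 (show dg Hᶜ u = 1 by omega)
  have hzu' : Hᶜ.Adj u z := by
    have := Finset.ext_iff.1 hz z
    simpa only [mem_filter, mem_univ, true_and, mem_singleton, iff_true] using this
  have hzu : z ≠ u := hzu'.ne'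
  have huz : ¬ H.Adj u z := hzu'.2
  have hZ : ∀ b, b ≠ u → ¬ H.Adj u b → b = z := fun b h1 h2 =>
    dg_le_one (show dg Hᶜ u ≤ 1 by omega) (SimpleGraph.compl_adj _ _ _ |>.2 ⟨h1.symm, h2⟩) hzu'
  obtain ⟨φ, hφ⟩ := h x0 hx0u
  have hφu : φ u = z ∧ (∀ b, H.Adj z b → b = x0) ∧ z ≠ x0 := by
    have e := hφ.cdg_eq hx0u.symm
    have e0 : cdg G x0 u = 0 := cdg_zero.2 hux
    rw [e0] at e
    have e1 := cdg_zero.1 e.symm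
    have : φ u = z := by
      apply hZ
      · intro h1
        rw [h1] at e
        have := dg_le_cdg H x0 u
        omega
      · intro h1
        exact hx0u (e1 u h1.symm).symm
    rw [this] at e1
    refine ⟨this, e1, ?_⟩
    rw [← this]; exact hφ.ne.2 hx0u.symm
  obtain ⟨hφu, hzx, hzx0⟩ := hφu
  have hzd : dg H z ≤ 1 := by
    have := cdg_zero.2 hzx
    have := dg_le_cdg H x0 z
    omega
  have hzd' := hd z hzu
  obtain ⟨χ, hχ⟩ := h z hzu
  have hcz : cdg H z u = dg H u := cdg_nadj (fun hh => huz hh.symm)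
  have hb : ∀ b, b ≠ z → b ≠ x0 → G.Adj x0 b := by
    have e := hχ.cdg_symm hzu.symm
    rw [hcz] at e
    have htz : χ.symm u ≠ z := hχ.symm.ne.2 hzu.symm
    set t := χ.symm u with ht
    have hfull : univ.filter (fun b => b ≠ z ∧ G.Adj t b) = univ \ {z, t} := by
      apply Finset.eq_of_subset_of_card_le
      · intro b hb
        simp only [mem_filter, mem_univ, true_and] at hb
        simp [hb.1, hb.2.ne']
      · have c : ({z, t} : Finset V).card = 2 := card_pair htz.symm
        rw [card_sdiff_of_subset (subset_univ _), c, card_univ]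
        unfold cdg at e
        omega
    have adj : ∀ b, b ≠ z → b ≠ t → G.Adj t b := by
      intro b h1 h2
      have : b ∈ univ \ {z, t} := by simp [h1, h2]
      rw [← hfull] at this
      simp at this; exact this.2
    have htu : t ≠ u := by
      intro hh
      rw [hh] at e
      have := cdg_le G z u
      omega
    have : t = x0 := hux t (adj u hzu.symm htu.symm).symm
    rw [this] at adj
    exact adj
  have hx0d : Fintype.card V ≤ dg G x0 + 2 := by
    have : univ \ {z, x0} ⊆ univ.filter (fun b => G.Adj x0 b) := by
      intro b hb'
      simp at hb'
      simp [hb b hb'.1 hb'.2]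
    have c := card_le_card this
    rw [card_sdiff_of_subset (subset_univ _), card_pair hzx0, card_univ] at c
    unfold dg; omega
  obtain ⟨y, hyz, hyu, hyd⟩ : ∃ y, y ≠ z ∧ y ≠ u ∧ dg H y ≤ 1 := by
    have e := hχ.cdg_eq hzu.symm
    have e' := cdg_le G z u
    refine ⟨χ u, hχ.ne.2 hzu.symm, ?_, ?_⟩
    · intro hh; rw [hh] at e; omega
    · have : χ u ≠ x0 := by
        intro hh
        rw [hh] at e
        have := dg_le_cdg H z x0
        have := hd x0 hx0u
        omega
      rw [← cdg_nadj (fun hh => this (hzx _ hh) : ¬ H.Adj z (χ u))]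
      omega
  obtain ⟨x, hxu, hxx0, hx⟩ : ∃ x, x ≠ u ∧ x ≠ x0 ∧ ∀ b, b ≠ u → b ≠ x → G.Adj x b := by
    have hxx0 : φ.symm u ≠ x0 := hφ.symm.ne.2 hx0u.symm
    have hxu : φ.symm u ≠ u := by
      intro hh
      rw [Equiv.symm_apply_eq, hφu] at hh
      exact hzu hh.symm
    refine ⟨φ.symm u, hxu, hxx0, ?_⟩
    set x := φ.symm u with hxdef
    have hφx : φ x = u := by simp [hxdef]
    have adj : ∀ b, b ≠ u → b ≠ x → b ≠ x0 → G.Adj x b := by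
      intro b h1 h2 h3
      rw [hφ.2 x b hxx0 h3, hφx]
      by_contra hh
      have : φ b = z := hZ _ (fun h4 => h2 (φ.injective (h4.trans hφx.symm))) hh
      exact h1 (φ.injective (this.trans hφu.symm))
    intro b h1 h2
    by_cases h3 : b = x0
    · subst h3
      refine (hb x ?_ h2.symm).symm
      intro hxz
      have : univ \ {u, x, b} ⊆ univ.filter (fun b => G.Adj x b) := by
        intro c hc'
        simp at hc'
        simp [adj c hc'.1 hc'.2.1 hc'.2.2]
      have c := card_le_card this
      have c3 : ({u, x, b} : Finset V).card ≤ 3 := card_le_three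
      rw [card_sdiff_of_subset (subset_univ _), card_univ] at c
      have : dg G x ≤ 2 := by rw [hxz]; omega
      unfold dg at this
      omega
    · exact adj b h1 h2 h3
  have hxd : Fintype.card V ≤ dg G x + 2 := by
    have : univ \ {u, x} ⊆ univ.filter (fun b => G.Adj x b) := by
      intro b hb'
      simp at hb'
      simp [hx b hb'.1 hb'.2]
    have c := card_le_card this
    rw [card_sdiff_of_subset (subset_univ _), card_pair hxu.symm, card_univ] at c
    unfold dg; omega
  have hxz : x ≠ z := by rintro rfl; omega
  have hz1 : dg H z = 1 := by
    by_contra hne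
    have hz0 : dg H z = 0 := by omega
    obtain ⟨v, hv⟩ := avoid {u, z, x0, x} (lt_of_le_of_lt card_le_four (by omega))
    simp only [mem_insert, mem_singleton, not_or] at hv
    obtain ⟨hvu, hvz, hvx0, hvx⟩ := hv
    obtain ⟨ψ, hψ⟩ := h v hvu
    have e := hψ.cdg_symm (Ne.symm hvz)
    have e1 : cdg H v z = 0 := by have := cdg_le H v z; omega
    have e2 := cdg_zero.1 (e.trans e1)
    set t := ψ.symm z
    have htv : t ≠ v := hψ.symm.ne.2 (Ne.symm hvz)
    by_cases t1 : t = x0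
    · rw [t1] at e2; exact hvu (e2 u hux0.symm).symm
    · by_cases t2 : t = z
      · rw [t2] at e2; exact hvx (e2 x (hx z hzu hxz.symm).symm).symm
      · exact hvx0 (e2 x0 (hb t t2 t1).symm).symm
  have key : ∀ v, v ≠ u → v ≠ x0 → v ≠ x → v ≠ z → v ≠ y → G.Adj z v := by
    intro v hvu hvx0 hvx hvz hvy
    obtain ⟨ψ, hψ⟩ := h v hvu
    have sub : ∀ s, dg H s ≤ 1 → v ≠ s → ψ.symm s ≠ u → G.Adj z v := by
      intro s hs hvs hne
      have e := hψ.cdg_symm (Ne.symm hvs)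
      have e1 := cdg_le H v s
      have htv : ψ.symm s ≠ v := hψ.symm.ne.2 (Ne.symm hvs)
      set t := ψ.symm s
      have t1 : t ≠ x0 := by
        intro hh; rw [hh] at e; have := dg_le_cdg G v x0; omega
      have t2 : t ≠ x := by
        intro hh; rw [hh] at e; have := dg_le_cdg G v x; omega
      by_cases t3 : t = z
      · by_contra hh
        rw [t3] at e
        have := cdg_nadj (fun h' => hh (SimpleGraph.Adj.symm h') : ¬ G.Adj v z)
        omega
      · exfalso
        exact hxx0 (cdg_le_one (e.trans_le (e1.trans hs)) (hx t hne t2).symm (hb t t3 t1).symm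
          (Ne.symm hvx) (Ne.symm hvx0))
    by_cases h1 : ψ.symm z = u
    · refine sub y hyd hvy ?_
      intro h2
      exact hyz (ψ.symm.injective (h2.trans h1.symm))
    · exact sub z hzd hvz h1
  obtain ⟨v3, hv3⟩ := avoid {u, x0, x, z, y} (lt_of_le_of_lt card_le_five (by omega))
  obtain ⟨v4, hv4⟩ := avoid {v3, u, x0, x, z, y} (lt_of_le_of_lt card_le_six (by omega))
  simp only [mem_insert, mem_singleton, not_or] at hv3 hv4
  obtain ⟨a1, a2, a3, a4, a5⟩ := hv3
  obtain ⟨b0, b1, b2, b3, b4, b5⟩ := hv4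
  have k3 := key v3 a1 a2 a3 a4 a5
  have k4 := key v4 b1 b2 b3 b4 b5
  have k5 : G.Adj z x := (hx z hzu hxz.symm).symm
  have : ({x, v3, v4} : Finset V) ⊆ univ.filter (fun b => G.Adj z b) := by
    intro b hb'
    simp only [mem_insert, mem_singleton] at hb'
    rcases hb' with rfl | rfl | rfl <;> simp [k3, k4, k5]
  have c := card_le_card this
  rw [card_eq_three.2 ⟨x, v3, v4, Ne.symm a3, Ne.symm b3, Ne.symm b0, rfl⟩] at c
  have : 3 ≤ dg G z := c
  omega

lemma myrvold_aux {G H : SimpleGraph V} {u : V} (hn : 7 ≤ Fintype.card V) (h : Sh G H u)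
    {k : ℤ} (hk : 0 < k) (h1 : ∀ v, v ≠ u → (dg G v : ℤ) - dg H v = k)
    (h2 : (dg H u : ℤ) - dg G u = (Fintype.card V - 3) * k) : False := by
  have c1 := dg_compl G u
  have c2 := dg_compl H u
  have hk1 : k = 1 := by
    by_contra hne
    have : 2 ≤ k := by omega
    have : ((Fintype.card V : ℤ) - 3) * 2 ≤ (Fintype.card V - 3) * k := by
      apply mul_le_mul_of_nonneg_left this; omega
    omega
  subst hk1
  have hd : ∀ v, v ≠ u → dg G v = dg H v + 1 := fun v hv => by have := h1 v hv; omega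
  have : dg G u = 0 ∨ dg G u = 1 ∨ dg G u = 2 := by omega
  rcases this with h0 | h0 | h0
  · exact g_zero hn h hd h0 (by omega)
  · exact g_one hn h hd h0 (by omega)
  · refine g_zero (G := Hᶜ) (H := Gᶜ) hn h.symm.compl ?_ (by omega) (by omega)
    intro v hv
    have := dg_compl G v
    have := dg_compl H v
    have := hd v hv
    omega

lemma myrvold {G H : SimpleGraph V} {u : V} (hn : 7 ≤ Fintype.card V) (h : Sh G H u) (v : V) :
    dg G v = dg H v := by
  obtain ⟨k, h1, h2⟩ := dg_diff (by omega) h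
  have hk : k = 0 := by
    rcases lt_trichotomy k 0 with hk | hk | hk
    · exfalso
      refine myrvold_aux (k := -k) hn h.symm (by omega) (fun v hv => ?_) ?_
      · have := h1 v hv; omega
      · linear_combination -h2
    · exact hk
    · exact (myrvold_aux hn h hk h1 h2).elim
  subst hk
  by_cases hv : v = u
  · subst hv; simp at h2; omega
  · have := h1 v hv; omega

end myrvold

section main
variable {V : Type*} [Fintype V]

/-- nonneighbours of `v` inside `L` -/
noncomputable def N (G : SimpleGraph V) (L : Finset V) (v : V) : Finset V :=
  L.filter (fun x => x ≠ v ∧ ¬ G.Adj v x)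

lemma mem_N {G : SimpleGraph V} {L : Finset V} {v x : V} :
    x ∈ N G L v ↔ x ∈ L ∧ x ≠ v ∧ ¬ G.Adj v x := by simp [N]

lemma N_comm {G : SimpleGraph V} {L : Finset V} {v x : V} (h : x ∈ N G L v) (hv : v ∈ L) :
    v ∈ N G L x := by
  rw [mem_N] at h ⊢
  exact ⟨hv, h.2.1.symm, fun h' => h.2.2 h'.symm⟩

structure Ctx (G H : SimpleGraph V) (u : V) (L : Finset V) (Δ c : ℕ) : Prop where
  sh : Sh G H u
  hd : ∀ v, dg G v = dg H v
  hL : ∀ x, x ∈ L ↔ dg G x = Δ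
  hmax : ∀ x, dg G x ≤ Δ
  hc : c + Δ + 1 = Fintype.card V

variable {G H : SimpleGraph V} {u : V} {L : Finset V} {Δ c : ℕ}

lemma Ctx.symm (C : Ctx G H u L Δ c) : Ctx H G u L Δ c :=
  ⟨C.sh.symm, fun v => (C.hd v).symm, fun x => by rw [C.hL, C.hd], fun x => by
    rw [← C.hd]; exact C.hmax x, C.hc⟩

lemma Ctx.mem_cdg (C : Ctx G H u L Δ c) {v x : V} (hx : x ≠ v) :
    x ∈ N G L v ↔ cdg G v x = Δ := by
  rw [mem_N, C.hL]
  have h1 := cdg_add G v x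
  have h2 := C.hmax x
  by_cases h : G.Adj v x
  · simp only [h, if_true] at h1
    simp [h]; omega
  · simp only [h, if_false] at h1
    simp [h, hx]; omega

lemma Ctx.map (C : Ctx G H u L Δ c) {v : V} {φ : V ≃ V} (h : CIso G H v φ) (x : V) :
    x ∈ N G L v ↔ φ x ∈ N H L v := by
  by_cases hx : x = v
  · subst hx
    rw [h.1]; simp [mem_N]
  · rw [C.mem_cdg hx, C.symm.mem_cdg (h.ne.2 hx), h.cdg_eq hx]

lemma Ctx.mapD (C : Ctx G H u L Δ c) {v : V} {φ : V ≃ V} (h : CIso G H v φ) (j : ℕ) {x : V}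
    (hx : x ∈ N G L v) : D G j x = D H j (φ x) := by
  have h2 := (C.map h x).1 hx
  rw [mem_N] at hx h2
  exact h.D_eq j hx.2.1 hx.2.2 h2.2.2

lemma Ctx.sum_N (C : Ctx G H u L Δ c) {v : V} (hv : v ≠ u) (j : ℕ) (g : ℤ → ℤ) :
    ∑ x ∈ N G L v, g (D G j x) = ∑ x ∈ N H L v, g (D H j x) := by
  obtain ⟨φ, h⟩ := C.sh v hv
  apply Finset.sum_equiv φ
  · intro x; exact C.map h x
  · intro x hx; rw [C.mapD h j hx]

lemma Ctx.ex_N (C : Ctx G H u L Δ c) {v : V} (hv : v ≠ u) (j : ℕ) {x : V} (hx : x ∈ N G L v) :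
    ∃ y ∈ N H L v, D H j y = D G j x := by
  obtain ⟨φ, h⟩ := C.sh v hv
  exact ⟨φ x, (C.map h x).1 hx, (C.mapD h j hx).symm⟩

lemma Ctx.cardNN (C : Ctx G H u L Δ c) {x : V} (hx : x ∈ L) :
    (univ.filter (fun v => v ≠ x ∧ ¬ G.Adj x v)).card = c := by
  have h1 := dg_compl G x
  have h2 : dg Gᶜ x = (univ.filter (fun v => v ≠ x ∧ ¬ G.Adj x v)).card := by
    unfold dg; congr 1; ext v; simp [SimpleGraph.compl_adj, eq_comm]
  have := C.hc
  rw [C.hL] at hx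
  omega

lemma Ctx.cardN_le (C : Ctx G H u L Δ c) {x : V} (hx : x ∈ L) : (N G L x).card ≤ c := by
  rw [← C.cardNN hx]
  apply card_le_card
  intro y hy
  rw [mem_N] at hy
  simpa using hy.2

lemma Ctx.dbl (C : Ctx G H u L Δ c) (f : V → ℤ) :
    ∑ v, ∑ x ∈ N G L v, f x = c * ∑ x ∈ L, f x := by
  have h1 : ∀ v, ∑ x ∈ N G L v, f x = ∑ x ∈ L, if x ≠ v ∧ ¬ G.Adj v x then f x else 0 := by
    intro v; unfold N; rw [Finset.sum_filter]
  simp only [h1]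
  rw [Finset.sum_comm, Finset.mul_sum]
  apply Finset.sum_congr rfl
  intro x hx
  rw [← Finset.sum_filter]
  have : (univ.filter (fun v => x ≠ v ∧ ¬ G.Adj v x)).card = c := by
    rw [← C.cardNN hx]
    congr 1; ext v; simp [eq_comm, G.adj_comm]
  simp [this]

lemma Ctx.I (C : Ctx G H u L Δ c) (j : ℕ) (g : ℤ → ℤ) :
    c * ∑ x ∈ L, g (D G j x) - ∑ x ∈ N G L u, g (D G j x)
      = c * ∑ x ∈ L, g (D H j x) - ∑ x ∈ N H L u, g (D H j x) := by
  rw [← C.dbl, ← C.symm.dbl, ← Finset.add_sum_erase _ _ (mem_univ u),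
    ← Finset.add_sum_erase univ (fun v => ∑ x ∈ N H L v, g (D H j x)) (mem_univ u)]
  have : ∑ v ∈ univ.erase u, ∑ x ∈ N G L v, g (D G j x)
      = ∑ v ∈ univ.erase u, ∑ x ∈ N H L v, g (D H j x) :=
    Finset.sum_congr rfl fun v hv => C.sum_N (ne_of_mem_erase hv) j g
  rw [this]; ring

lemma Ctx.cardN (C : Ctx G H u L Δ c) (v : V) : (N G L v).card = (N H L v).card := by
  by_cases hv : v = u
  · subst hv
    have := C.I 0 (fun _ => 1)
    simp at this
    exact this
  · have := C.sum_N hv 0 (fun _ => 1)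
    simpa using this

lemma Ctx.clique_iff (C : Ctx G H u L Δ c) : G.IsClique (L : Set V) ↔ ∀ v ∈ L, (N G L v).card = 0 := by
  simp only [card_eq_zero, Finset.eq_empty_iff_forall_notMem, mem_N, SimpleGraph.isClique_iff,
    Set.Pairwise, mem_coe]
  constructor
  · intro h v hv x hx
    exact hx.2.2 (h hv hx.1 hx.2.1.symm)
  · intro h v hv x hx hvx
    by_contra h'
    exact h v hv x ⟨hx, hvx.symm, h'⟩

lemma Ctx.clique_symm (C : Ctx G H u L Δ c) (h : H.IsClique (L : Set V)) :
    G.IsClique (L : Set V) := by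
  rw [C.clique_iff]
  rw [C.symm.clique_iff] at h
  intro v hv; rw [C.cardN]; exact h v hv

lemma Ctx.Dk (C : Ctx G H u L Δ c) (r : ℕ) {x : V} (hx : x ≠ u) :
    D G r x - D H r x = K G r - K H r := by
  obtain ⟨φ, h⟩ := C.sh x hx
  exact h.K_sub r

/-- all nonneighbours in `L` -/
lemma Ctx.nn_eq (C : Ctx G H u L Δ c) {x : V} (hx : x ∈ L) (hN : (N G L x).card = c) (b : V) :
    b ∈ N G L x ↔ b ≠ x ∧ ¬ G.Adj x b := by
  have : N G L x = univ.filter (fun v => v ≠ x ∧ ¬ G.Adj x v) := by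
    apply Finset.eq_of_subset_of_card_le
    · intro y hy
      rw [mem_N] at hy
      simpa using hy.2
    · rw [C.cardNN hx, hN]
  rw [this]; simp

lemma Ctx.S (C : Ctx G H u L Δ c) {x : V} (hx : x ∈ L) (hxu : x ≠ u)
    (hN : (N G L x).card = c) (r : ℕ) (hr : 1 ≤ r) : K G r = K H r := by
  obtain ⟨φ, h⟩ := C.sh x hxu
  obtain ⟨j, rfl⟩ : ∃ j, r = j + 1 := ⟨r - 1, by omega⟩
  have key : D G (j+1) x = D H (j+1) x := by
    rw [D_succ, D_succ]
    have hh := h.count j (fun s => ∀ b ∈ s, b ∉ N H L x)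
    have e1 : (cl G j).filter (fun s => x ∉ s ∧ ∀ b ∈ s, G.Adj x b)
        = (cl G j).filter (fun s => x ∉ s ∧ ∀ b ∈ s.map φ.toEmbedding, b ∉ N H L x) := by
      apply Finset.filter_congr
      intro s _
      refine and_congr_right fun hs => ?_
      simp only [mem_map, Equiv.coe_toEmbedding, forall_exists_index, and_imp,
        forall_apply_eq_imp_iff₂, ← C.map h, C.nn_eq hx hN]
      refine forall₂_congr fun b hb => ?_
      have : b ≠ x := by rintro rfl; exact hs hb
      tauto
    have e2 : (cl H j).filter (fun s => x ∉ s ∧ ∀ b ∈ s, H.Adj x b)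
        = (cl H j).filter (fun s => x ∉ s ∧ ∀ b ∈ s, b ∉ N H L x) := by
      apply Finset.filter_congr
      intro s _
      refine and_congr_right fun hs => ?_
      simp only [C.symm.nn_eq hx (by rw [← C.cardN, hN])]
      refine forall₂_congr fun b hb => ?_
      have : b ≠ x := by rintro rfl; exact hs hb
      tauto
    norm_cast
    rw [e1, e2]
    convert hh
  have := C.Dk (j+1) hxu
  linarith

lemma K_zero (G H : SimpleGraph V) : K G 0 = K H 0 := by
  unfold K cl
  congr 2
  ext s
  simp only [mem_filter, mem_univ, true_and, SimpleGraph.isNClique_iff, card_eq_zero]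
  constructor
  · rintro ⟨_, rfl⟩; simp
  · rintro ⟨_, rfl⟩; simp

lemma K_ge (G : SimpleGraph V) {r : ℕ} (hr : Fintype.card V ≤ r) {v : V}
    (hv : dg G v + 1 < Fintype.card V) : K G r = 0 := by
  unfold K cl
  norm_cast
  rw [card_eq_zero, Finset.eq_empty_iff_forall_notMem]
  intro s hs
  simp only [mem_filter, mem_univ, true_and, SimpleGraph.isNClique_iff] at hs
  have h1 : s = univ := by
    rw [← Finset.card_eq_iff_eq_univ]
    have := Finset.card_le_univ s
    omega
  subst h1
  have h2 : univ.erase v ⊆ univ.filter (fun b => G.Adj v b) := by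
    intro b hb
    simp only [mem_filter, mem_univ, true_and]
    exact hs.1 (by simp) (by simp) (ne_of_mem_erase hb).symm
  have h3 := card_le_card h2
  rw [card_erase_of_mem (mem_univ v), card_univ] at h3
  unfold dg at hv
  omega

lemma Ctx.univ_succ (C : Ctx G H u L Δ 0) (hu : u ∈ L) (j : ℕ) :
    D G (j+1) u = K G j - D G j u := by
  have h := C.cardNN hu
  rw [card_eq_zero, Finset.eq_empty_iff_forall_notMem] at h
  simp only [mem_filter, mem_univ, true_and, not_and, not_not] at h
  rw [D_succ, K_split G j u]
  have : (cl G j).filter (fun s => u ∉ s ∧ ∀ b ∈ s, G.Adj u b)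
      = (cl G j).filter (fun s => u ∉ s) := by
    apply Finset.filter_congr
    intro s _
    refine and_iff_left_of_imp fun hs b hb => h b ?_
    rintro rfl; exact hs hb
  rw [this]; ring

lemma Ctx.case0 (C : Ctx G H u L Δ 0) (hV : 2 ≤ Fintype.card V) (hL : L.Nonempty) (r : ℕ) (hr : 1 ≤ r)
    (hne : K G r ≠ K H r) : L = {u} ∧ r + 1 = Fintype.card V := by
  have h1 : ∀ x ∈ L, x = u := by
    intro x hx
    by_contra hxu
    exact hne (C.S hx hxu (by have := C.cardN_le hx; omega) r hr)
  have hu : u ∈ L := by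
    obtain ⟨x, hx⟩ := hL
    rwa [← h1 x hx]
  have h2 : L = {u} := by
    ext x; simp only [mem_singleton]
    exact ⟨h1 x, by rintro rfl; exact hu⟩
  refine ⟨h2, ?_⟩
  have h3 : ∀ j : ℕ, j + 2 ≤ Fintype.card V → K G j = K H j := by
    intro j
    induction j with
    | zero => intro _; exact K_zero G H
    | succ j ih =>
      intro hj
      have e0 := ih (by omega)
      have e1 := C.univ_succ hu j
      have e2 := C.symm.univ_succ hu j
      have e3 := D_u C.sh j
      have e4 := D_u C.sh (j+1)
      have e5 : ((Fintype.card V : ℤ) - 1 - ((j+1 : ℕ) : ℤ)) * (K G (j+1) - K H (j+1)) = 0 := by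
        rw [← e4, e1, e2]
        rw [e0] at e3 ⊢
        simp only [sub_self, mul_zero] at e3
        linarith
      rcases mul_eq_zero.1 e5 with h | h
      · exfalso; push_cast at h; omega
      · linarith
  have h4 : Fintype.card V < r + 2 := by
    by_contra h
    exact hne (h3 r (by omega))
  have h5 : r < Fintype.card V := by
    by_contra h
    apply hne
    obtain ⟨v, hv⟩ := avoid L (by rw [h2]; simp; omega)
    have hv' : dg G v + 1 < Fintype.card V := by
      have := C.hc
      have := C.hmax v
      rw [C.hL] at hv
      omega
    rw [K_ge G (by omega) hv', K_ge H (by omega) (v := v) (by rw [← C.hd]; exact hv')]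
  omega

lemma Ctx.c1_one (C : Ctx G H u L Δ 1) {x : V} (hx : x ∈ L) (j : ℕ) :
    D G (j+1) x + D G j x + ∑ y ∈ univ.filter (fun v => v ≠ x ∧ ¬ G.Adj x v), D G j y = K G j := by
  have h := C.cardNN hx
  obtain ⟨y, hy⟩ := card_eq_one.1 h
  rw [hy, sum_singleton]
  rw [Finset.ext_iff] at hy
  simp only [mem_filter, mem_univ, true_and, mem_singleton] at hy
  have hyx := (hy y).2 rfl
  rw [K_split G j x, D_succ]
  have e := Finset.card_filter_add_card_filter_not (s := (cl G j).filter (fun s => x ∉ s))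
    (fun s => y ∈ s)
  have e1 : ((cl G j).filter (fun s => x ∉ s)).filter (fun s => y ∈ s)
      = (cl G j).filter (fun s => y ∈ s) := by
    rw [Finset.filter_filter]
    apply Finset.filter_congr
    intro s hs
    simp only [cl, mem_filter, mem_univ, true_and, SimpleGraph.isNClique_iff] at hs
    refine and_iff_right_of_imp fun hys hxs => hyx.2 ?_
    exact hs.1 hxs hys hyx.1.symm
  have e2 : ((cl G j).filter (fun s => x ∉ s)).filter (fun s => ¬ y ∈ s)
      = (cl G j).filter (fun s => x ∉ s ∧ ∀ b ∈ s, G.Adj x b) := by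
    rw [Finset.filter_filter]
    apply Finset.filter_congr
    intro s hs
    refine and_congr_right fun hxs => ⟨fun hys b hb => ?_, fun h hys => hyx.2 (h y hys)⟩
    by_contra hb'
    have := (hy b).1 ⟨by rintro rfl; exact hxs hb, hb'⟩
    subst this; exact hys hb
  rw [e1, e2] at e
  unfold D
  rw [← e]; push_cast; ring

lemma Ctx.c1_sum (C : Ctx G H u L Δ 1) (j : ℕ) :
    ∑ x ∈ L, D G (j+1) x + ∑ x ∈ L, D G j x + ∑ y, ((N G L y).card : ℤ) * D G j y
      = L.card * K G j := by
  have h1 : ∑ y, ((N G L y).card : ℤ) * D G j y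
      = ∑ x ∈ L, ∑ y ∈ univ.filter (fun v => v ≠ x ∧ ¬ G.Adj x v), D G j y := by
    simp only [Finset.sum_filter]
    rw [Finset.sum_comm]
    apply Finset.sum_congr rfl
    intro y _
    rw [← Finset.sum_filter]
    simp only [sum_const, nsmul_eq_mul]
    congr 3
    ext x
    simp only [mem_N, mem_filter, ne_eq, eq_comm, G.adj_comm]
  rw [h1, ← Finset.sum_add_distrib, ← Finset.sum_add_distrib,
    Finset.sum_congr rfl (fun x hx => C.c1_one hx j)]
  simp

lemma Ctx.case_c1 (C : Ctx G H u L Δ 1) (hu : u ∉ L) (hL : L.Nonempty) (j : ℕ) :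
    K G j = K H j := by
  induction j with
  | zero => exact K_zero G H
  | succ j ih =>
    have e1 := C.c1_sum j
    have e2 := C.symm.c1_sum j
    have e3 : ∀ y, D G j y = D H j y := by
      intro y
      by_cases hy : y = u
      · subst hy
        have := D_u C.sh j
        rw [ih, sub_self, mul_zero] at this
        linarith
      · have := C.Dk j hy
        linarith
    simp only [e3, C.cardN, ih] at e1
    have e4 : ∑ x ∈ L, D G (j+1) x - ∑ x ∈ L, D H (j+1) x = 0 := by linarith
    rw [← Finset.sum_sub_distrib, Finset.sum_congr rfl (g := fun _ => K G (j+1) - K H (j+1))] at e4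
    · simp only [sum_const, nsmul_eq_mul, mul_eq_zero, Nat.cast_eq_zero, card_eq_zero] at e4
      rcases e4 with h | h
      · exact absurd h hL.ne_empty
      · linarith
    · intro x hx
      exact C.Dk (j+1) (by rintro rfl; exact hu hx)

lemma Ctx.ex_nn (C : Ctx G H u L Δ c) (hc : 2 ≤ c) {x : V} (hx : x ∈ L) :
    ∃ v, v ≠ u ∧ x ∈ N G L v := by
  have h := C.cardNN hx
  obtain ⟨v, hv, hvu⟩ := Finset.exists_mem_ne (s := univ.filter (fun v => v ≠ x ∧ ¬ G.Adj x v))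
    (by omega) u
  refine ⟨v, hvu, ?_⟩
  simp only [mem_filter, mem_univ, true_and] at hv
  rw [mem_N]
  exact ⟨hx, hv.1.symm, fun h => hv.2 h.symm⟩

/-- maximum argument -/
lemma Ctx.maxarg (C : Ctx G H u L Δ c) (hc : 2 ≤ c) {r : ℕ} (hk : K H r < K G r)
    {x : V} (hx : x ∈ L) (hm : ∀ y ∈ L, y ≠ u → D G r y ≤ D G r x) :
    u ∈ L ∧ D H r u = D G r x := by
  obtain ⟨v, hv, hxv⟩ := C.ex_nn hc hx
  obtain ⟨y, hy, hyx⟩ := C.ex_N hv r hxv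
  rw [mem_N] at hy
  by_cases hyu : y = u
  · subst hyu; exact ⟨hy.1, hyx⟩
  · exfalso
    have := C.Dk r hyu
    have := hm y hy.1 hyu
    linarith

lemma Ctx.minarg (C : Ctx G H u L Δ c) (hc : 2 ≤ c) {r : ℕ} (hk : K H r < K G r)
    {x : V} (hx : x ∈ L) (hxu : x ≠ u) (hm : ∀ y ∈ L, y ≠ u → D G r x ≤ D G r y) :
    u ∈ L ∧ D G r u = D G r x - (K G r - K H r) := by
  obtain ⟨v, hv, hxv⟩ := C.symm.ex_nn hc hx
  obtain ⟨y, hy, hyx⟩ := C.symm.ex_N hv r hxv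
  rw [mem_N] at hy
  have h1 := C.Dk r hxu
  by_cases hyu : y = u
  · subst hyu; exact ⟨hy.1, by linarith⟩
  · exfalso
    have := hm y hy.1 hyu
    linarith

lemma Ctx.not_mem (C : Ctx G H u L Δ c) (hc : 2 ≤ c) {r : ℕ} (hk : K H r < K G r)
    (hL : L.Nonempty) : u ∈ L := by
  obtain ⟨x, hx, hm⟩ := Finset.exists_max_image L (D G r) hL
  exact (C.maxarg hc hk hx (fun y hy _ => hm y hy)).1

/-- if `u` is not in `L`, everything agrees -/
lemma Ctx.mem_u (C : Ctx G H u L Δ c) (hL : L.Nonempty) {r : ℕ} (hr : 1 ≤ r)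
    (hne : K G r ≠ K H r) : u ∈ L := by
  by_contra hu
  rcases Nat.lt_or_ge c 2 with hc | hc
  · interval_cases c
    · obtain ⟨x, hx⟩ := hL
      exact hne (C.S hx (by rintro rfl; exact hu hx) (by have := C.cardN_le hx; omega) r hr)
    · exact hne (C.case_c1 hu hL r)
  · rcases lt_or_gt_of_ne hne with h | h
    · exact hu (C.symm.not_mem hc h hL)
    · exact hu (C.not_mem hc h hL)

lemma Ctx.claim1 (C : Ctx G H u L Δ c) (hc : 1 ≤ c) (hu : u ∈ L) {r : ℕ} (hr : 1 ≤ r)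
    (hk : K H r < K G r) : (N G L u).card < c := by
  refine lt_of_le_of_ne (C.cardN_le hu) fun ha => ?_
  have hS : ∀ x ∈ L, x ≠ u → (N G L x).card < c := fun x hx hxu =>
    lt_of_le_of_ne (C.cardN_le hx) fun h => hk.ne' (C.S hx hxu h r hr)
  obtain ⟨x0, hx0⟩ : (N G L u).Nonempty := by rw [← card_pos]; omega
  have hx0' := mem_N.1 hx0
  rcases hc.eq_or_lt with hc1 | hc2
  · have := hS x0 hx0'.1 hx0'.2.1
    have h2 : 0 < (N G L x0).card := card_pos.2 ⟨u, N_comm hx0 hu⟩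
    omega
  have hc2 : 2 ≤ c := hc2
  have hA : (L.erase u).Nonempty := ⟨x0, mem_erase.2 ⟨hx0'.2.1, hx0'.1⟩⟩
  obtain ⟨xM, hxM, hM⟩ := Finset.exists_max_image (L.erase u) (D G r) hA
  obtain ⟨xm, hxm, hm⟩ := Finset.exists_min_image (L.erase u) (D G r) hA
  have hq := (C.maxarg hc2 hk (mem_of_mem_erase hxM) (fun y hy hyu => hM y (mem_erase.2 ⟨hyu, hy⟩))).2
  have hp := (C.minarg hc2 hk (mem_of_mem_erase hxm) (ne_of_mem_erase hxm)
    (fun y hy hyu => hm y (mem_erase.2 ⟨hyu, hy⟩))).2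
  have hpq : D G r u < D H r u := by
    have := hM xm hxm
    linarith
  have hQu : ∀ x, D G r x = D H r u → x ≠ u := by
    rintro x hx rfl; omega
  have hHq : ∀ x ∈ L, D H r x = D H r u → x = u := by
    intro x hx h
    by_contra hxu
    have := C.Dk r hxu
    have := hM x (mem_erase.2 ⟨hxu, hx⟩)
    linarith
  set q := D H r u with hqdef
  set Q := L.filter (fun x => D G r x = q) with hQ
  have hI := C.I r (fun t => if t = q then 1 else 0)
  have i1 : (L.filter (fun x => D H r x = q)) = {u} := by
    ext x; simp only [mem_filter, mem_singleton]
    exact ⟨fun h => hHq x h.1 h.2, by rintro rfl; exact ⟨hu, rfl⟩⟩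
  have i2 : ((N H L u).filter (fun x => D H r x = q)) = ∅ := by
    rw [Finset.eq_empty_iff_forall_notMem]
    intro x hx
    rw [mem_filter, mem_N] at hx
    exact hx.1.2.1 (hHq x hx.1.1 hx.2)
  rw [Finset.sum_boole, Finset.sum_boole, Finset.sum_boole, Finset.sum_boole, i1, i2, ← hQ] at hI
  simp only [card_singleton, card_empty] at hI
  set R := (N G L u).filter (fun x => D G r x = q) with hR
  have hRQ : R ⊆ Q := by
    intro x hx
    rw [hR, mem_filter, mem_N] at hx
    rw [hQ, mem_filter]; exact ⟨hx.1.1, hx.2⟩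
  have hRQc := card_le_card hRQ
  have hI' : c * Q.card = R.card + c := by
    push_cast at hI
    have : (c * Q.card : ℤ) = R.card + c := by linarith
    exact_mod_cast this
  have hg : ∀ γ ∈ N H L u, γ ≠ u ∧ ∃ x ∈ Q, x ≠ u ∧ γ ∈ N G L x := by
    intro γ hγ
    have hγ' := mem_N.1 hγ
    refine ⟨hγ'.2.1, ?_⟩
    obtain ⟨x, hx, hxq⟩ := C.symm.ex_N hγ'.2.1 r (N_comm hγ hu)
    have hx' := mem_N.1 hx
    exact ⟨x, mem_filter.2 ⟨hx'.1, hxq⟩, hQu x hxq, N_comm hx hγ'.1⟩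
  have hNH : (N H L u).card = c := by rw [← C.cardN, ha]
  have hQ3 : Q.card < 3 := by
    by_contra h
    have : 3 ≤ Q.card := by omega
    nlinarith
  have hQ0 : Q.card ≠ 0 := by
    intro h; rw [h] at hI'; omega
  obtain ⟨γ, hγ⟩ : (N H L u).Nonempty := by rw [← card_pos]; omega
  have hQ12 : Q.card = 1 ∨ Q.card = 2 := by omega
  rcases hQ12 with h1 | h2
  · obtain ⟨x, hx⟩ := card_eq_one.1 h1
    have hxQ : x ∈ Q := by rw [hx]; simp
    have hxL := (mem_filter.1 hxQ)
    have hsub : N H L u ⊆ N G L x := by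
      intro δ hδ
      obtain ⟨_, z, hz, _, hz2⟩ := hg δ hδ
      rw [hx, mem_singleton] at hz
      subst hz; exact hz2
    have := card_le_card hsub
    have := hS x hxL.1 (hQu x hxL.2)
    omega
  · have hRc : R.card = c := by rw [h2] at hI'; omega
    have hRQ' : R = Q := Finset.eq_of_subset_of_card_le hRQ (by omega)
    obtain ⟨hγu, x, hx, hxu, hxγ⟩ := hg γ hγ
    have hxR : x ∈ R := by rw [hRQ']; exact hx
    have hxN := (mem_filter.1 hxR).1
    have hxL := (mem_filter.1 hx).1
    have hsub : {u, γ} ⊆ N G L x := by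
      intro z hz
      simp only [mem_insert, mem_singleton] at hz
      rcases hz with rfl | rfl
      · exact N_comm hxN hu
      · exact hxγ
    have h3 := card_le_card hsub
    rw [card_pair hγu.symm] at h3
    have := hS x hxL hxu
    omega

lemma Ctx.counts (C : Ctx G H u L Δ c) (r : ℕ) (ha : (N G L u).card < c) (t : ℤ) :
    (L.filter (fun x => D G r x = t)).card = (L.filter (fun x => D H r x = t)).card := by
  have hI := C.I r (fun s => if s = t then 1 else 0)
  rw [Finset.sum_boole, Finset.sum_boole, Finset.sum_boole, Finset.sum_boole] at hI
  have h1 : ((N G L u).filter (fun x => D G r x = t)).card ≤ (N G L u).card :=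
    card_le_card (filter_subset _ _)
  have h2 : ((N H L u).filter (fun x => D H r x = t)).card ≤ (N H L u).card :=
    card_le_card (filter_subset _ _)
  rw [← C.cardN] at h2
  generalize ((N G L u).filter (fun x => D G r x = t)).card = y1 at *
  generalize ((N H L u).filter (fun x => D H r x = t)).card = y2 at *
  generalize (L.filter (fun x => D G r x = t)).card = x1 at *
  generalize (L.filter (fun x => D H r x = t)).card = x2 at *
  rcases lt_trichotomy x1 x2 with h | h | h
  · exfalso
    have : (c : ℤ) * (x2 - x1) = y2 - y1 := by linarith
    have h3 : (1 : ℤ) ≤ x2 - x1 := by omega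
    have h4 : (y2 : ℤ) - y1 < c := by omega
    have h5 : (0 : ℤ) ≤ c := by omega
    nlinarith
  · exact h
  · exfalso
    have : (c : ℤ) * (x1 - x2) = y1 - y2 := by linarith
    have h3 : (1 : ℤ) ≤ x1 - x2 := by omega
    have h4 : (y1 : ℤ) - y2 < c := by omega
    have h5 : (0 : ℤ) ≤ c := by omega
    nlinarith

lemma Ctx.claim2 (C : Ctx G H u L Δ c) (hu : u ∈ L) {r : ℕ} (hk : K H r < K G r)
    (hcount : ∀ t, (L.filter (fun x => D G r x = t)).card = (L.filter (fun x => D H r x = t)).card) :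
    r + L.card = Fintype.card V := by
  have hms : L.val.map (D G r) = L.val.map (D H r) := by
    ext t
    rw [Multiset.count_map, Multiset.count_map]
    have := hcount t
    simp only [Finset.card_def, Finset.filter_val] at this
    simp only [eq_comm (a := t)]
    convert this
  have hs : ∑ x ∈ L, D G r x = ∑ x ∈ L, D H r x := by
    rw [Finset.sum, Finset.sum, hms]
  rw [← Finset.add_sum_erase _ _ hu, ← Finset.add_sum_erase L (D H r) hu] at hs
  have h1 : ∑ x ∈ L.erase u, D G r x - ∑ x ∈ L.erase u, D H r x
      = (L.card - 1) * (K G r - K H r) := by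
    rw [← Finset.sum_sub_distrib, Finset.sum_congr rfl (g := fun _ => K G r - K H r)]
    · have : 0 < L.card := card_pos.2 ⟨u, hu⟩
      simp [Finset.card_erase_of_mem hu, Nat.cast_sub this]; ring
    · intro x hx
      exact C.Dk r (ne_of_mem_erase hx)
  have h2 := D_u C.sh r
  have h3 : ((Fintype.card V : ℤ) - r - L.card) * (K G r - K H r) = 0 := by
    linear_combination h1 - h2 - hs
  rcases mul_eq_zero.1 h3 with h | h
  · omega
  · omega

lemma D_nonneg (G : SimpleGraph V) (r : ℕ) (x : V) : 0 ≤ D G r x := by unfold D; positivity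

lemma Ctx.struct (C : Ctx G H u L Δ c) (hu : u ∈ L) {r : ℕ} (hk : K H r < K G r)
    (hcount : ∀ t, (L.filter (fun x => D G r x = t)).card = (L.filter (fun x => D H r x = t)).card)
    (t : ℤ) : (L.filter (fun x => D G r x = t)).card ≤ 1 ∧
      ∀ x ∈ L, D G r x = t → ∃ i : ℕ, t = D G r u + i * (K G r - K H r) := by
  have key : ∀ m : ℕ, ∀ t : ℤ, t < m → (L.filter (fun x => D G r x = t)).card ≤ 1 ∧
      ∀ x ∈ L, D G r x = t → ∃ i : ℕ, t = D G r u + i * (K G r - K H r) := by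
    intro m
    induction m with
    | zero =>
      intro t ht
      have h0 : ∀ x ∈ L, D G r x ≠ t := by
        intro x _ h
        have := D_nonneg G r x
        push_cast at ht; omega
      refine ⟨?_, fun x hx h => absurd h (h0 x hx)⟩
      rw [Finset.filter_false_of_mem h0]; simp
    | succ m ih =>
      intro t ht
      obtain ⟨ih1, ih2⟩ := ih (t - (K G r - K H r)) (by push_cast at ht; omega)
      have hA : ∀ x ∈ L, x ≠ u → D G r x = t → ∃ y ∈ L, D G r y = t - (K G r - K H r) := by
        intro x hx hxu hxt
        have h1 := C.Dk r hxu
        have : 0 < (L.filter (fun x => D H r x = t - (K G r - K H r))).card :=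
          card_pos.2 ⟨x, mem_filter.2 ⟨hx, by linarith⟩⟩
        rw [← hcount] at this
        obtain ⟨y, hy⟩ := card_pos.1 this
        rw [mem_filter] at hy
        exact ⟨y, hy⟩
      have hB : ∀ x ∈ L, x ≠ u → D G r x = t →
          ∃ i : ℕ, t = D G r u + (i + 1) * (K G r - K H r) := by
        intro x hx hxu hxt
        obtain ⟨y, hy, hyt⟩ := hA x hx hxu hxt
        obtain ⟨i, hi⟩ := ih2 y hy hyt
        exact ⟨i, by linear_combination hi⟩
      constructor
      · rw [Finset.card_le_one]
        intro a ha b hb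
        rw [mem_filter] at ha hb
        have hne : ∀ x ∈ L, D G r x = t → x ≠ u → D G r u ≠ t := by
          intro x hx hxt hxu hut
          obtain ⟨i, hi⟩ := hB x hx hxu hxt
          have : (0:ℤ) < ((i:ℤ) + 1) * (K G r - K H r) := by
            apply mul_pos <;> omega
          omega
        by_cases hau : a = u
        · subst hau
          by_contra hab
          exact hne b hb.1 hb.2 (Ne.symm hab) ha.2
        · by_cases hbu : b = u
          · subst hbu
            exact absurd hb.2 (hne a ha.1 ha.2 hau)
          · rw [hcount, Finset.card_le_one] at ih1
            have h1 := C.Dk r hau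
            have h2 := C.Dk r hbu
            exact ih1 a (mem_filter.2 ⟨ha.1, by linarith⟩) b (mem_filter.2 ⟨hb.1, by linarith⟩)
      · intro x hx hxt
        by_cases hxu : x = u
        · subst hxu; exact ⟨0, by simp [hxt]⟩
        · obtain ⟨i, hi⟩ := hB x hx hxu hxt
          exact ⟨i + 1, by push_cast; exact hi⟩
  exact key (t.toNat + 1) t (by push_cast; have := Int.self_le_toNat t; omega)

lemma Ctx.claim3 (C : Ctx G H u L Δ c) (hu : u ∈ L) {r : ℕ} (hk : K H r < K G r)
    (hcount : ∀ t, (L.filter (fun x => D G r x = t)).card = (L.filter (fun x => D H r x = t)).card) :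
    G.IsClique (L : Set V) := by
  have hst := C.struct hu hk hcount
  have injG : ∀ x ∈ L, ∀ y ∈ L, D G r x = D G r y → x = y := by
    intro x hx y hy h
    have := (hst (D G r y)).1
    rw [Finset.card_le_one] at this
    exact this x (mem_filter.2 ⟨hx, h⟩) y (mem_filter.2 ⟨hy, rfl⟩)
  have injH : ∀ x ∈ L, ∀ y ∈ L, D H r x = D H r y → x = y := by
    intro x hx y hy h
    have := (hst (D H r y)).1
    rw [hcount, Finset.card_le_one] at this
    exact this x (mem_filter.2 ⟨hx, h⟩) y (mem_filter.2 ⟨hy, rfl⟩)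
  have hval : ∀ x ∈ L, ∃ i : ℕ, D G r x = D G r u + i * (K G r - K H r) := fun x hx =>
    (hst (D G r x)).2 x hx rfl
  have hmaxH : ∀ x ∈ L, D H r x ≤ D H r u := by
    intro x hx
    by_cases hxu : x = u
    · rw [hxu]
    have hA : (L.erase u).Nonempty := ⟨x, mem_erase.2 ⟨hxu, hx⟩⟩
    obtain ⟨xM, hxM, hM⟩ := Finset.exists_max_image (L.erase u) (D G r) hA
    have : 0 < (L.filter (fun x => D G r x = D G r xM)).card :=
      card_pos.2 ⟨xM, mem_filter.2 ⟨mem_of_mem_erase hxM, rfl⟩⟩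
    rw [hcount] at this
    obtain ⟨y, hy⟩ := card_pos.1 this
    rw [mem_filter] at hy
    by_cases hyu : y = u
    · subst hyu
      have := C.Dk r hxu
      have := hM x (mem_erase.2 ⟨hxu, hx⟩)
      linarith [hy.2]
    · exfalso
      have := C.Dk r hyu
      have := hM y (mem_erase.2 ⟨hyu, hy.1⟩)
      linarith [hy.2]
  have hadj : ∀ i : ℕ, 1 ≤ i → ∀ x ∈ L, ∀ x' ∈ L,
      D G r x = D G r x' + i * (K G r - K H r) → G.Adj x x' := by
    intro i
    induction i using Nat.strong_induction_on with
    | _ i ih =>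
      intro hi x hx x' hx' h
      by_contra hn
      have hipos : (0:ℤ) < i * (K G r - K H r) := by apply mul_pos <;> omega
      have hxu : x ≠ u := by
        rintro rfl
        obtain ⟨i', hi'⟩ := hval x' hx'
        have : (0:ℤ) ≤ i' * (K G r - K H r) := by apply mul_nonneg <;> omega
        linarith
      have hxx' : x' ≠ x := by rintro rfl; linarith
      obtain ⟨y, hy, hyx⟩ := C.ex_N hxu r (mem_N.2 ⟨hx', hxx', hn⟩)
      have hy' := mem_N.1 hy
      have hDx := C.Dk r hxu
      have e1 : D H r x = D H r y + (i - 1) * (K G r - K H r) := by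
        linear_combination h - hyx - hDx
      rcases hi.eq_or_lt with h1 | h2
      · subst h1
        apply hy'.2.1
        apply injH y hy'.1 x hx
        push_cast at e1; linarith
      · have hi1 : (0:ℤ) < ((i:ℤ) - 1) * (K G r - K H r) := by apply mul_pos <;> omega
        have hyu : y ≠ u := by
          rintro rfl
          have := hmaxH x hx
          linarith
        obtain ⟨z, hz, hzx⟩ := C.symm.ex_N hyu r (N_comm hy hx)
        have hz' := mem_N.1 hz
        have hDy := C.Dk r hyu
        have e2 : D G r z = D G r y + (i - 2) * (K G r - K H r) := by
          linear_combination hzx + e1 - hDy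
        have h2 : 2 ≤ i := h2
        rcases h2.eq_or_lt with h3 | h3
        · subst h3
          apply hz'.2.1
          apply injG z hz'.1 y hy'.1
          push_cast at e2; linarith
        · have := ih (i - 2) (by omega) (by omega) z hz'.1 y hy'.1
            (by rw [Nat.cast_sub h2]; push_cast; exact e2)
          exact hz'.2.2 this.symm
  intro x hx y hy hxy
  obtain ⟨i, hi⟩ := hval x hx
  obtain ⟨j, hj⟩ := hval y hy
  rcases lt_trichotomy i j with h | h | h
  · refine (hadj (j - i) (by omega) y hy x hx ?_).symm
    rw [Nat.cast_sub h.le]; linear_combination hj - hi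
  · exact absurd (injG x hx y hy (by rw [hi, hj, h])) hxy
  · refine hadj (i - j) (by omega) x hx y hy ?_
    rw [Nat.cast_sub h.le]; linear_combination hi - hj

lemma Ctx.main (C : Ctx G H u L Δ c) (hV : 2 ≤ Fintype.card V) (hL : L.Nonempty) {r : ℕ}
    (hr : 1 ≤ r) (hne : K G r ≠ K H r) :
    G.IsClique (L : Set V) ∧ r + L.card = Fintype.card V := by
  rcases Nat.eq_zero_or_pos c with hc | hc
  · subst hc
    obtain ⟨h1, h2⟩ := C.case0 hV hL r hr hne
    subst h1
    simpa using h2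
  have hu := C.mem_u hL hr hne
  rcases lt_or_gt_of_ne hne with h | h
  · have hcount := C.symm.counts r (C.symm.claim1 hc hu hr h)
    exact ⟨C.clique_symm (C.symm.claim3 hu h hcount), C.symm.claim2 hu h hcount⟩
  · have hcount := C.counts r (C.claim1 hc hu hr h)
    exact ⟨C.claim3 hu h hcount, C.claim2 hu h hcount⟩

end main

section reduction
variable {n : ℕ}

lemma kappa_eq (G : SimpleGraph (Fin n)) (r : ℕ) : (kappa G r : ℤ) = K G r := by
  unfold kappa K cl
  norm_cast
  rw [← Set.ncard_coe_finset]
  congr 1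
  ext s; simp [SimpleGraph.mem_cliqueSet_iff]

lemma deg_eq (G : SimpleGraph (Fin n)) (v : Fin n) : deg G v = dg G v := by
  unfold deg dg
  rw [← Set.ncard_coe_finset]
  congr 1
  ext s; simp

lemma kappa_iso {G H : SimpleGraph (Fin n)} (π : Fin n ≃ Fin n)
    (h : ∀ a b, G.Adj a b ↔ H.Adj (π a) (π b)) (r : ℕ) : K G r = K H r := by
  unfold K
  norm_cast
  apply Finset.card_equiv π.finsetCongr
  intro s
  simp only [cl, mem_filter, mem_univ, true_and, Equiv.finsetCongr_apply,
    SimpleGraph.isNClique_iff, card_map, SimpleGraph.isClique_iff, Set.Pairwise, mem_coe,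
    mem_map_equiv]
  refine and_congr ?_ Iff.rfl
  constructor
  · intro h1 a ha b hb hab
    have := (h _ _).1 (h1 ha hb (by simpa using hab))
    simpa using this
  · intro h1 a ha b hb hab
    exact (h a b).2 (h1 (by simpa using ha) (by simpa using hb) (by simpa using hab))

/-- extend a bijection of punctured sets -/
lemma extend {W : Type*} [Fintype W] (u w : W) (π : {x : W // x ≠ u} ≃ {y : W // y ≠ w}) :
    ∃ σ : W ≃ W, σ u = w ∧ ∀ x (hx : x ≠ u), σ x = (π ⟨x, hx⟩).1 := by
  refine ⟨π.extendSubtype, ?_, ?_⟩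
  · have := π.extendSubtype_not_mem u (by simp)
    simpa using this
  · intro x hx
    exact π.extendSubtype_apply_of_mem x hx

lemma reduce {G H : SimpleGraph (Fin n)} (h : ShareCards G H) :
    ∃ (H' : SimpleGraph (Fin n)) (u : Fin n), Sh G H' u ∧ ∀ r, K H' r = K H r := by
  obtain ⟨u, w, π, hπ⟩ := h
  obtain ⟨σ, hσu, hσ⟩ := extend u w π
  refine ⟨H.comap σ, u, ?_, fun r => kappa_iso σ (fun a b => Iff.rfl) r⟩
  intro v hv
  obtain ⟨e⟩ := hπ ⟨v, hv⟩
  have hw : (π ⟨v, hv⟩).1 = σ v := (hσ v hv).symm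
  obtain ⟨τ, hτv, hτ⟩ := extend v (π ⟨v, hv⟩).1 e.toEquiv
  refine ⟨τ.trans σ.symm, ?_, ?_⟩
  · simp [hτv, hw]
  · intro a b ha hb
    have := e.map_rel_iff (a := ⟨a, ha⟩) (b := ⟨b, hb⟩)
    simp only [Equiv.trans_apply, SimpleGraph.comap_adj, Equiv.apply_symm_apply]
    rw [hτ a ha, hτ b hb]
    exact this.symm

lemma final (hn : 7 ≤ n) (G H : SimpleGraph (Fin n)) (hshare : ShareCards G H)
    (r : ℕ) (hr : 1 ≤ r) (hk : kappa G r ≠ kappa H r) :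
    G.IsClique {v : Fin n | deg G v = maxDeg G} ∧ r = n - numMaxDeg G := by
  obtain ⟨H', u, hsh, hK⟩ := reduce hshare
  have hcard : 7 ≤ Fintype.card (Fin n) := by simpa using hn
  have hle : ∀ v, dg G v ≤ maxDeg G := by
    intro v; rw [← deg_eq]
    exact Finset.le_sup (f := fun v => deg G v) (mem_univ v)
  have : Nonempty (Fin n) := ⟨⟨0, by omega⟩⟩
  obtain ⟨x, -, hx⟩ := Finset.exists_mem_eq_sup (univ : Finset (Fin n)) univ_nonempty
    (fun v => deg G v)
  have hx' : deg G x = maxDeg G := hx.symm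
  have hlt : maxDeg G + 1 ≤ Fintype.card (Fin n) := by
    have := dg_compl G x
    rw [← hx', deg_eq]; omega
  have C : Ctx G H' u (univ.filter (fun v => deg G v = maxDeg G)) (maxDeg G)
      (Fintype.card (Fin n) - (maxDeg G + 1)) :=
    ⟨hsh, myrvold hcard hsh, fun x => by simp [deg_eq], hle, by omega⟩
  obtain ⟨h1, h2⟩ := C.main (r := r) (by omega) ⟨x, by simp [hx']⟩ hr (by
    rw [hK, ← kappa_eq, ← kappa_eq]; exact_mod_cast hk)
  constructor
  · simpa using h1
  · have : numMaxDeg G = (univ.filter (fun v => deg G v = maxDeg G)).card := by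
      unfold numMaxDeg; congr!
    rw [Fintype.card_fin] at h2
    omega

end reduction
end MDC

theorem maxDeg_clique_of_ne {n : ℕ} (hn : 7 ≤ n)
    (G H : SimpleGraph (Fin n)) (hshare : ShareCards G H)
    (r : ℕ) (hr : 1 ≤ r) (hk : kappa G r ≠ kappa H r) :
    G.IsClique {v : Fin n | deg G v = maxDeg G} ∧ r = n - numMaxDeg G := by
  exact MDC.final hn G H hshare r hr hk
end

section
/- Let n ≥ 7 and let G and H be simple graphs on n vertices that share n−1 cards. If κ_r(G) ≠ κ_r(H) for some integer r ≥ 1, then: (i) for every integer r' ≥ 1 with r' ≠ r, all vertices of maximum degree of G have the same K_{r'}-degree (deg_{r'}(v,G) = deg_{r'}(v',G) whenever deg(v,G) = deg(v',G) = Δ(G)); and (ii) the K_r-degrees of the vertices of maximum degree of G form an arithmetic progression, i.e., listing { deg_r(v,G) : deg(v,G) = Δ(G) } in decreasing order as d_1 ≥ d_2 ≥ … ≥ d_ℓ, the difference d_i − d_{i+1} is the same for all 1 ≤ i ≤ ℓ−1. -/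
open SimpleGraph

section basics
open Classical
variable {V : Type*} [Fintype V]

/-- number of `s`-cliques disjoint from `W`. -/
noncomputable def cntW (G : SimpleGraph V) (s : ℕ) (W : Finset V) : ℕ :=
  (Finset.univ.filter (fun t : Finset V => G.IsNClique s t ∧ Disjoint t W)).card

lemma kappa_eq_card (G : SimpleGraph V) (s : ℕ) :
    kappa G s = (Finset.univ.filter (fun t : Finset V => G.IsNClique s t)).card := by
  unfold kappa
  rw [← Set.ncard_coe_finset]
  congr 1
  ext t; simp

lemma degR_eq_card (G : SimpleGraph V) (s : ℕ) (v : V) :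
    degR G s v = (Finset.univ.filter (fun t : Finset V => G.IsNClique s t ∧ v ∈ t)).card := by
  unfold degR
  rw [← Set.ncard_coe_finset]
  congr 1
  ext t; simp

lemma deg_eq_card (G : SimpleGraph V) (v : V) :
    deg G v = (Finset.univ.filter (fun x : V => G.Adj v x)).card := by
  unfold deg
  rw [← Set.ncard_coe_finset]
  congr 1
  ext t; simp

lemma cntW_empty (G : SimpleGraph V) (s : ℕ) : cntW G s ∅ = kappa G s := by
  rw [kappa_eq_card]; simp [cntW]

lemma cntW_zero (G : SimpleGraph V) (W : Finset V) : cntW G 0 W = 1 := by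
  unfold cntW
  rw [Finset.card_eq_one]
  refine ⟨∅, ?_⟩
  ext t
  simp only [Finset.mem_filter, Finset.mem_univ, true_and, isNClique_zero, Finset.mem_singleton]
  constructor
  · exact fun h => h.1
  · rintro rfl; simp

lemma degR_zero (G : SimpleGraph V) (v : V) : degR G 0 v = 0 := by
  rw [degR_eq_card]
  rw [Finset.card_eq_zero, Finset.filter_eq_empty_iff]
  rintro t - ⟨h, h'⟩
  rw [isNClique_zero] at h
  simp [h] at h'

lemma degR_add_cntW (G : SimpleGraph V) (s : ℕ) (v : V) :
    degR G s v + cntW G s {v} = kappa G s := by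
  rw [kappa_eq_card, degR_eq_card, cntW]
  rw [← Finset.card_filter_add_card_filter_not (s := Finset.univ.filter (fun t : Finset V => G.IsNClique s t)) (fun t => v ∈ t)]
  simp only [Finset.filter_filter, Finset.disjoint_singleton_right]

/-- cliques through `y` avoiding `W`. -/
lemma card_through (G : SimpleGraph V) (s : ℕ) (y : V) (W W' : Finset V) (hy : y ∉ W)
    (hW : ∀ z, z ∈ W' ↔ z ∈ W ∨ ¬ G.Adj y z) :
    (Finset.univ.filter (fun t : Finset V => G.IsNClique (s+1) t ∧ Disjoint t W ∧ y ∈ t)).card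
      = cntW G s W' := by
  unfold cntW
  symm
  apply Finset.card_bij (fun t _ => insert y t)
  · intro t ht
    simp only [Finset.mem_filter, Finset.mem_univ, true_and] at ht ⊢
    obtain ⟨h1, h2⟩ := ht
    rw [Finset.disjoint_left] at h2
    refine ⟨h1.insert ?_, ?_, by simp⟩
    · intro b hb
      have := h2 hb
      rw [hW] at this; tauto
    · rw [Finset.disjoint_left]
      intro a ha
      rcases Finset.mem_insert.1 ha with rfl | ha
      · exact hy
      · have := h2 ha
        rw [hW] at this; tauto
  · intro t ht t' ht' h
    simp only [Finset.mem_filter, Finset.mem_univ, true_and, Finset.disjoint_left] at ht ht'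
    have h1 : y ∉ t := fun h => ht.2 h ((hW y).2 (Or.inr (G.loopless.irrefl y)))
    have h2 : y ∉ t' := fun h => ht'.2 h ((hW y).2 (Or.inr (G.loopless.irrefl y)))
    rw [← Finset.erase_insert h1, h, Finset.erase_insert h2]
  · intro t ht
    simp only [Finset.mem_filter, Finset.mem_univ, true_and] at ht
    obtain ⟨h1, h2, h3⟩ := ht
    refine ⟨t.erase y, ?_, Finset.insert_erase h3⟩
    simp only [Finset.mem_filter, Finset.mem_univ, true_and]
    refine ⟨by simpa using h1.erase_of_mem h3, ?_⟩
    rw [Finset.disjoint_left] at h2 ⊢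
    intro a ha
    rw [Finset.mem_erase] at ha
    rw [hW]
    have := h1.isClique h3 ha.2 (Ne.symm ha.1)
    have := h2 ha.2
    tauto

lemma cntW_rec (G : SimpleGraph V) (s : ℕ) (y : V) (W W' : Finset V) (hy : y ∉ W)
    (hW : ∀ z, z ∈ W' ↔ z ∈ W ∨ ¬ G.Adj y z) :
    cntW G (s+1) W = cntW G (s+1) (insert y W) + cntW G s W' := by
  rw [← card_through G s y W W' hy hW]
  unfold cntW
  rw [← Finset.card_filter_add_card_filter_not (s := Finset.univ.filter (fun t : Finset V => G.IsNClique (s+1) t ∧ Disjoint t W)) (fun t => y ∈ t), add_comm]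
  simp only [Finset.filter_filter, Finset.disjoint_insert_right]
  congr 3
  · ext t; tauto
  · ext t; tauto

lemma degR_succ (G : SimpleGraph V) (s : ℕ) (y : V) (W' : Finset V)
    (hW : ∀ z, z ∈ W' ↔ ¬ G.Adj y z) : degR G (s+1) y = cntW G s W' := by
  rw [← card_through G s y ∅ W' (by simp) (by simpa using hW), degR_eq_card]
  simp

/-- dominating vertex -/
lemma degR_dom (G : SimpleGraph V) (s : ℕ) (x : V) (hx : ∀ y, y ≠ x → G.Adj x y) :
    degR G (s+1) x + degR G s x = kappa G s := by
  rw [degR_succ G s x {x}, add_comm, degR_add_cntW]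
  intro z
  rw [Finset.mem_singleton]
  constructor
  · rintro rfl; exact G.loopless.irrefl z
  · intro h; by_contra h'; exact h (hx z h')

/-- vertex with a unique non-neighbour -/
lemma degR_leaf (G : SimpleGraph V) (s : ℕ) (x u : V) (hxu : x ≠ u) (hn : ¬ G.Adj x u)
    (hx : ∀ y, y ≠ x → y ≠ u → G.Adj x y) :
    degR G (s+1) x + degR G s x + degR G s u = kappa G s := by
  have hW : ∀ z, z ∈ ({x, u} : Finset V) ↔ ¬ G.Adj x z := by
    intro z
    rw [Finset.mem_insert, Finset.mem_singleton]
    constructor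
    · rintro (rfl | rfl)
      · exact G.loopless.irrefl _
      · exact hn
    · intro h; by_contra h'; push Not at h'; exact h (hx z h'.1 h'.2)
  have h1 := degR_add_cntW G s u
  have h0 := degR_succ G s x {x,u} hW
  cases s with
  | zero => simp only [cntW_zero, degR_zero] at *; omega
  | succ s =>
    have h2 := degR_succ G s x {x,u} hW
    have h3 := cntW_rec G s x {u} {x,u} (by simpa using hxu) (by
      intro z
      rw [hW, Finset.mem_singleton]
      constructor
      · tauto
      · rintro (rfl | h)
        · exact hn
        · exact h)
    omega

lemma degR_two (G : SimpleGraph V) (v : V) : degR G 2 v = deg G v := by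
  rw [degR_succ G 1 v (Finset.univ.filter (fun z => ¬ G.Adj v z)) (by simp), deg_eq_card, cntW]
  symm
  apply Finset.card_bij (fun x _ => {x})
  · intro x hx
    simpa using hx
  · intro a _ b _ h; simpa using h
  · intro t ht
    simp only [Finset.mem_filter, Finset.mem_univ, true_and, isNClique_one] at ht
    obtain ⟨⟨a, rfl⟩, h⟩ := ht
    refine ⟨a, by simpa using h, rfl⟩

lemma sum_degR (G : SimpleGraph V) (s : ℕ) : ∑ v, degR G s v = s * kappa G s := by
  simp only [degR_eq_card, kappa_eq_card, Finset.card_filter]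
  rw [Finset.sum_comm, Finset.mul_sum]
  apply Finset.sum_congr rfl
  intro t _
  by_cases h : G.IsNClique s t
  · simp [h, h.card_eq]
  · simp [h]

/-- cliques of a card -/
lemma ncard_gcard (G : SimpleGraph V) (v : V) (s : ℕ) (P : Finset V → Prop)
    (Q : Finset {x : V // x ≠ v} → Prop)
    (hQ : ∀ t, Q t ↔ P (t.map (Function.Embedding.subtype _))) :
    {t : Finset {x : V // x ≠ v} | (gcard G v).IsNClique s t ∧ Q t}.ncard
    = {t : Finset V | G.IsNClique s t ∧ v ∉ t ∧ P t}.ncard := by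
  have key : ∀ t : Finset {x : V // x ≠ v}, (gcard G v).IsNClique s t ↔
      G.IsNClique s (t.map (Function.Embedding.subtype _)) := by
    intro t
    exact isNClique_induce_iff {x | x ≠ v} t s
  apply Set.ncard_congr (fun t _ => t.map (Function.Embedding.subtype _))
  · intro t ht
    simp only [Set.mem_setOf_eq] at ht ⊢
    refine ⟨(key t).1 ht.1, ?_, (hQ t).1 ht.2⟩
    simp
  · intro a b _ _ h
    exact Finset.map_injective _ h
  · intro t ht
    simp only [Set.mem_setOf_eq] at ht
    have : (t.subtype (fun x => x ≠ v)).map (Function.Embedding.subtype _) = t := by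
      rw [Finset.subtype_map]
      apply Finset.filter_true_of_mem
      rintro x hx rfl
      exact ht.2.1 hx
    refine ⟨t.subtype (fun x => x ≠ v), ?_, this⟩
    simp only [Set.mem_setOf_eq]
    rw [key, hQ, this]
    exact ⟨ht.1, ht.2.2⟩

lemma kappa_gcard (G : SimpleGraph V) (v : V) (s : ℕ) :
    kappa (gcard G v) s = cntW G s {v} := by
  have := ncard_gcard G v s (fun _ => True) (fun _ => True) (fun _ => Iff.rfl)
  rw [kappa, cntW, ← Set.ncard_coe_finset]
  simpa [cliqueSet] using this

lemma degR_gcard (G : SimpleGraph V) (v : V) (s : ℕ) (x : {x : V // x ≠ v})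
    (h : ¬ G.Adj v x) : degR (gcard G v) s x = degR G s x := by
  have := ncard_gcard G v s (fun t => x.1 ∈ t) (fun t => x ∈ t) (by
    intro t
    simp only [Finset.mem_map, Function.Embedding.coe_subtype, Subtype.exists]
    constructor
    · intro h; exact ⟨x.1, x.2, h, rfl⟩
    · rintro ⟨a, ha, h1, h2⟩
      have : x = ⟨a, ha⟩ := Subtype.ext h2.symm
      rw [this]; exact h1)
  unfold degR
  refine Eq.trans this ?_
  congr 1
  ext t
  simp only [Set.mem_setOf_eq, mem_cliqueSet_iff]
  constructor
  · tauto
  · rintro ⟨h1, h2⟩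
    refine ⟨h1, fun hv => ?_, h2⟩
    exact h (h1.isClique hv h2 (Ne.symm x.2))

lemma deg_gcard (G : SimpleGraph V) (v : V) (x : {x : V // x ≠ v}) :
    deg (gcard G v) x + (if G.Adj v x then 1 else 0) = deg G x := by
  rw [deg_eq_card, deg_eq_card]
  have h1 : (Finset.univ.filter (fun y => (gcard G v).Adj x y)).card
      = ((Finset.univ.filter (fun y => G.Adj x y)).erase v).card := by
    apply Finset.card_bij (fun y _ => y.1)
    · intro a ha
      simp only [Finset.mem_filter, Finset.mem_univ, true_and, Finset.mem_erase] at ha ⊢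
      exact ⟨a.2, ha⟩
    · intro a _ b _ h; exact Subtype.ext h
    · intro b hb
      simp only [Finset.mem_filter, Finset.mem_univ, true_and, Finset.mem_erase] at hb
      refine ⟨⟨b, hb.1⟩, ?_, rfl⟩
      simp only [Finset.mem_filter, Finset.mem_univ, true_and]
      exact hb.2
  rw [h1]
  split_ifs with h
  · apply Finset.card_erase_add_one
    simpa using h.symm
  · rw [Finset.erase_eq_of_notMem, add_zero]
    simpa using fun h' => h (SimpleGraph.Adj.symm h')

section iso
set_option linter.unusedSectionVars false
variable {U : Type*} [Fintype U]
lemma isNClique_iso {G : SimpleGraph V} {K : SimpleGraph U} (φ : G ≃g K) (s : ℕ) (t : Finset V) :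
    K.IsNClique s (t.map φ.toEquiv.toEmbedding) ↔ G.IsNClique s t := by
  rw [isNClique_iff, isNClique_iff, Finset.card_map]
  apply and_congr_left'
  simp only [isClique_iff, Finset.coe_map]
  constructor
  · intro h a ha b hb hab
    have := h (Set.mem_image_of_mem _ ha) (Set.mem_image_of_mem _ hb) (by simpa using hab)
    exact φ.map_adj_iff.1 this
  · rintro h _ ⟨a, ha, rfl⟩ _ ⟨b, hb, rfl⟩ hab
    apply φ.map_adj_iff.2
    exact h ha hb (fun e => hab (by rw [e]))

lemma kappa_iso {G : SimpleGraph V} {K : SimpleGraph U} (φ : G ≃g K) (s : ℕ) :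
    kappa G s = kappa K s := by
  rw [kappa_eq_card, kappa_eq_card]
  apply Finset.card_bij (fun t _ => t.map φ.toEquiv.toEmbedding)
  · intro t ht; simpa [isNClique_iso] using ht
  · intro a _ b _ h; exact Finset.map_injective _ h
  · intro t ht
    have e : (t.map φ.symm.toEquiv.toEmbedding).map φ.toEquiv.toEmbedding = t := by
      rw [Finset.map_map]
      have : (φ.symm.toEquiv.toEmbedding).trans φ.toEquiv.toEmbedding = Function.Embedding.refl _ := by
        ext x; exact φ.apply_symm_apply x
      rw [this, Finset.map_refl]
    refine ⟨t.map φ.symm.toEquiv.toEmbedding, ?_, e⟩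
    rw [Finset.mem_filter] at ht ⊢
    refine ⟨Finset.mem_univ _, ?_⟩
    rw [← isNClique_iso φ, e]; exact ht.2

lemma degR_iso {G : SimpleGraph V} {K : SimpleGraph U} (φ : G ≃g K) (s : ℕ) (x : V) :
    degR K s (φ x) = degR G s x := by
  rw [degR_eq_card, degR_eq_card]
  symm
  apply Finset.card_bij (fun t _ => t.map φ.toEquiv.toEmbedding)
  · intro t ht
    rw [Finset.mem_filter] at ht ⊢
    exact ⟨Finset.mem_univ _, (isNClique_iso φ s t).2 ht.2.1, Finset.mem_map_of_mem φ.toEquiv.toEmbedding ht.2.2⟩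
  · intro a _ b _ h; exact Finset.map_injective _ h
  · intro t ht
    have e : (t.map φ.symm.toEquiv.toEmbedding).map φ.toEquiv.toEmbedding = t := by
      rw [Finset.map_map]
      have : (φ.symm.toEquiv.toEmbedding).trans φ.toEquiv.toEmbedding = Function.Embedding.refl _ := by
        ext x; exact φ.apply_symm_apply x
      rw [this, Finset.map_refl]
    refine ⟨t.map φ.symm.toEquiv.toEmbedding, ?_, e⟩
    rw [Finset.mem_filter] at ht ⊢
    refine ⟨Finset.mem_univ _, ?_, ?_⟩
    · rw [← isNClique_iso φ, e]; exact ht.2.1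
    · rw [Finset.mem_map]
      exact ⟨φ x, ht.2.2, φ.symm_apply_apply x⟩

lemma deg_iso {G : SimpleGraph V} {K : SimpleGraph U} (φ : G ≃g K) (x : V) :
    deg K (φ x) = deg G x := by
  rw [← degR_two, ← degR_two, degR_iso]
end iso

/-- cycle-lemma, inductive form -/
lemma cycle_aux (G : SimpleGraph V) (S : V → Prop)
    (hS : ∀ x, S x → ∀ a, a ≠ x → ¬ G.Adj x a → S a ∧ ∃ b, b ≠ a ∧ b ≠ x ∧ ∀ z, ¬ G.Adj x z ↔ (z = x ∨ z = a ∨ z = b)) :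
    ∀ (s : ℕ) (W : Finset V) (a b x y : V), a ∈ W → b ∈ W → x ∉ W → y ∉ W → S x → S y →
      ¬ G.Adj a x → ¬ G.Adj b y →
      (∀ w ∈ W, ∀ z, z ∉ W → ¬ G.Adj w z → (w = a ∧ z = x) ∨ (w = b ∧ z = y)) →
      cntW G s (insert x W) = cntW G s (insert y W) := by
  intro s
  induction s with
  | zero => intros; rw [cntW_zero, cntW_zero]
  | succ s ih =>
    intro W a b x y ha hb hx hy hSx hSy hax hby hW
    by_cases hxy : x = y
    · rw [hxy]
    obtain ⟨-, x', hx'a, hx'x, hxn⟩ := hS x hSx a (fun h => hx (h ▸ ha)) (fun h => hax h.symm)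
    obtain ⟨-, y', hy'b, hy'y, hyn⟩ := hS y hSy b (fun h => hy (h ▸ hb)) (fun h => hby h.symm)
    have hSx' := (hS x hSx x' hx'x (by rw [hxn]; simp)).1
    have hSy' := (hS y hSy y' hy'y (by rw [hyn]; simp)).1
    have hx'W : x' ∉ W := by
      intro h
      rcases hW x' h x hx (fun h => ((hxn x').2 (by simp)) h.symm) with h | h
      · exact hx'a h.1
      · exact hxy h.2
    have hy'W : y' ∉ W := by
      intro h
      rcases hW y' h y hy (fun h => ((hyn y').2 (by simp)) h.symm) with h | h
      · exact hxy h.2.symm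
      · exact hy'b h.1
    have r1 := cntW_rec G s y (insert x W) (insert y' (insert y (insert x W)))
      (by simp [Ne.symm hxy, hy]) (by
        intro z
        rw [hyn]
        simp only [Finset.mem_insert]
        constructor
        · tauto
        · rintro ((h | h) | h | rfl | h) <;> tauto)
    have r2 := cntW_rec G s x (insert y W) (insert x' (insert y (insert x W)))
      (by simp [hxy, hx]) (by
        intro z
        rw [hxn]
        simp only [Finset.mem_insert]
        constructor
        · tauto
        · rintro ((h | h) | h | rfl | h) <;> tauto)
    rw [r1, r2, Finset.insert_comm x y W]
    congr 1
    have sx : ∀ {p q}, ¬ G.Adj p q → ¬ G.Adj q p := fun h h' => h h'.symm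
    by_cases hc : x' = y
    · subst hc
      have : y' = x := by
        have := (hyn x).1 (sx ((hxn x').2 (by simp)))
        rcases this with h | h | h
        · exact absurd h hxy
        · exact absurd (h ▸ hb) hx
        · exact h.symm
      subst this
      congr 1
      ext z; simp only [Finset.mem_insert]; tauto
    · have hc' : y' ≠ x := by
        rintro rfl
        have := (hxn y).1 (sx ((hyn y').2 (by simp)))
        rcases this with h | h | h
        · exact hxy h.symm
        · exact hy (h ▸ ha)
        · exact hc h.symm
      symm
      apply ih (insert y (insert x W)) x y x' y' (by simp) (by simp) (by simp [*]) (by simp [*]) hSx' hSy'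
        ((hxn _).2 (by simp)) ((hyn _).2 (by simp))
      intro w hw z hz hwz
      simp only [Finset.mem_insert, not_or] at hw hz
      rcases hw with rfl | rfl | hw
      · right
        refine ⟨rfl, ?_⟩
        rcases (hyn z).1 hwz with h | h | h
        · exact absurd h hz.1
        · exact absurd (h ▸ hb) hz.2.2
        · exact h
      · left
        refine ⟨rfl, ?_⟩
        rcases (hxn z).1 hwz with h | h | h
        · exact absurd h hz.2.1
        · exact absurd (h ▸ ha) hz.2.2
        · exact h
      · rcases hW w hw z hz.2.2 hwz with h | h
        · exact absurd h.2 hz.2.1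
        · exact absurd h.2 hz.1

lemma cycle_lemma (G : SimpleGraph V) (S : V → Prop)
    (hS : ∀ x, S x → ∀ a, a ≠ x → ¬ G.Adj x a → S a ∧ ∃ b, b ≠ a ∧ b ≠ x ∧ ∀ z, ¬ G.Adj x z ↔ (z = x ∨ z = a ∨ z = b))
    (x y : V) (hx : S x) (hxy : x ≠ y) (hn : ¬ G.Adj x y) (s : ℕ) : degR G s x = degR G s y := by
  cases s with
  | zero => rw [degR_zero, degR_zero]
  | succ s =>
    have hn' : ¬ G.Adj y x := fun h => hn h.symm
    obtain ⟨hy, x', h1, h2, h3⟩ := hS x hx y hxy.symm hn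
    obtain ⟨-, y', h4, h5, h6⟩ := hS y hy x hxy hn'
    have hx' := (hS x hx x' h2 (by rw [h3]; simp)).1
    have hy' := (hS y hy y' h5 (by rw [h6]; simp)).1
    rw [degR_succ G s x (insert x' {x, y}) (by intro z; rw [h3]; simp; tauto),
      degR_succ G s y (insert y' {x, y}) (by intro z; rw [h6]; simp; tauto)]
    apply cycle_aux G S hS s {x,y} x y x' y' (by simp) (by simp) (by simp [*]) (by simp [*]) hx' hy'
      (by rw [h3]; simp) (by rw [h6]; simp)
    intro w hw z hz hwz
    simp only [Finset.mem_insert, Finset.mem_singleton, not_or] at hw hz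
    rcases hw with rfl | rfl
    · left
      have := (h3 z).1 hwz
      tauto
    · right
      have := (h6 z).1 hwz
      tauto

end basics


section cards
open Classical
variable {V : Type*} [Fintype V]

lemma card_kappa_rel {G H : SimpleGraph V} {v : V} (h : Nonempty (gcard G v ≃g gcard H v)) (s : ℕ) :
    (degR H s v : ℤ) = degR G s v + ((kappa H s : ℤ) - kappa G s) := by
  obtain ⟨φ⟩ := h
  have h1 := kappa_iso φ s
  rw [kappa_gcard, kappa_gcard] at h1
  have h2 := degR_add_cntW G s v
  have h3 := degR_add_cntW H s v
  omega

lemma missing_rel {G H : SimpleGraph V} {u : V}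
    (h : ∀ v, v ≠ u → Nonempty (gcard G v ≃g gcard H v)) (s : ℕ) :
    (degR G s u : ℤ) - degR H s u = ((Fintype.card V : ℤ) - s - 1) * ((kappa H s : ℤ) - kappa G s) := by
  have h1 := sum_degR G s
  have h2 := sum_degR H s
  rw [← Finset.add_sum_erase _ _ (Finset.mem_univ u)] at h1 h2
  have h3 : ∑ v ∈ Finset.univ.erase u, (degR H s v : ℤ)
      = ∑ v ∈ Finset.univ.erase u, ((degR G s v : ℤ) + ((kappa H s : ℤ) - kappa G s)) :=
    Finset.sum_congr rfl (fun v hv => card_kappa_rel (h v (Finset.ne_of_mem_erase hv)) s)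
  rw [Finset.sum_add_distrib, Finset.sum_const, Finset.card_erase_of_mem (Finset.mem_univ u),
    Finset.card_univ, nsmul_eq_mul] at h3
  have hpos : 1 ≤ Fintype.card V := Fintype.card_pos_iff.2 ⟨u⟩
  push_cast [hpos] at h3
  zify at h1 h2
  rw [h3] at h2
  linarith

/-- sums over a card of isomorphism invariants -/
lemma card_sum {G H : SimpleGraph V} {v : V} (h : Nonempty (gcard G v ≃g gcard H v))
    {M : Type*} [AddCommMonoid M] (Φ : ℕ → (ℕ → ℕ) → M) :
    ∑ x : {x : V // x ≠ v}, Φ (deg (gcard G v) x) (fun s => degR (gcard G v) s x)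
    = ∑ x : {x : V // x ≠ v}, Φ (deg (gcard H v) x) (fun s => degR (gcard H v) s x) := by
  obtain ⟨φ⟩ := h
  refine Fintype.sum_equiv φ.toEquiv _ _ (fun x => ?_)
  have h1 : deg (gcard H v) (φ x) = deg (gcard G v) x := deg_iso φ x
  have h2 : (fun s => degR (gcard H v) s (φ x)) = fun s => degR (gcard G v) s x := by
    funext s; exact degR_iso φ s x
  change _ = Φ (deg (gcard H v) (φ x)) (fun s => degR (gcard H v) s (φ x))
  rw [h1, h2]

lemma sum_ne {M : Type*} [AddCommMonoid M] (v : V) [Fintype {x : V // x ≠ v}]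
    (g : {x : V // x ≠ v} → M) (f : V → M)
    (h : ∀ x, g x = f x.1) :
    ∑ x : {x : V // x ≠ v}, g x = ∑ x ∈ Finset.univ.erase v, f x := by
  rw [Finset.sum_subtype (Finset.univ.erase v) (p := fun x => x ≠ v) (by simp)]
  exact Finset.sum_congr rfl (fun x _ => h x)

/-- neighbours of degree `k` -/
noncomputable def nb (G : SimpleGraph V) (v : V) (k : ℕ) : ℕ :=
  (Finset.univ.filter (fun x => G.Adj v x ∧ deg G x = k)).card

noncomputable def tot (G : SimpleGraph V) (k : ℕ) : ℕ :=
  (Finset.univ.filter (fun x => deg G x = k)).card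

lemma card_degree_count {G H : SimpleGraph V} {v : V} (h : Nonempty (gcard G v ≃g gcard H v)) (k : ℕ) :
    (tot G k : ℤ) - (if deg G v = k then 1 else 0) - nb G v k + nb G v (k+1)
    = (tot H k : ℤ) - (if deg H v = k then 1 else 0) - nb H v k + nb H v (k+1) := by
  have key : ∀ G : SimpleGraph V,
      ∑ x : {x : V // x ≠ v}, (if deg (gcard G v) x = k then (1:ℤ) else 0)
      = (tot G k : ℤ) - (if deg G v = k then 1 else 0) - nb G v k + nb G v (k+1) := by
    intro G
    let f : V → ℤ := fun x : V => (if deg G x = k then (1:ℤ) else 0) - (if G.Adj v x ∧ deg G x = k then 1 else 0)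
          + (if G.Adj v x ∧ deg G x = k+1 then 1 else 0)
    have e : ∀ x : {x : V // x ≠ v}, (if deg (gcard G v) x = k then (1:ℤ) else 0) = f x.1 := by
      intro x
      have := deg_gcard G v x
      simp only [f]
      by_cases ha : G.Adj v x <;> simp only [ha, if_true, if_false, true_and, false_and] at this ⊢ <;>
        split_ifs <;> omega
    rw [sum_ne v _ f e]
    have this := Finset.add_sum_erase Finset.univ f (Finset.mem_univ v)
    have h2 : ∑ x, f x = (tot G k : ℤ) - nb G v k + nb G v (k+1) := by
      simp only [f]
      rw [Finset.sum_add_distrib, Finset.sum_sub_distrib, Finset.sum_boole, Finset.sum_boole, Finset.sum_boole]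
      rfl
    have h3 : f v = if deg G v = k then (1:ℤ) else 0 := by
      simp [f]
    rw [h2, h3] at this
    linarith
  rw [← key G, ← key H]
  exact card_sum h (fun d _ => if d = k then (1:ℤ) else 0)


lemma tot_succ_split (G : SimpleGraph V) (u : V) (k : ℕ) :
    ((Finset.univ.erase u).filter (fun x => deg G x = k)).card + (if deg G u = k then 1 else 0) = tot G k := by
  unfold tot
  rw [Finset.filter_erase]
  split_ifs with h
  · apply Finset.card_erase_add_one; simpa using h
  · rw [Finset.erase_eq_of_notMem, add_zero]; simpa using h

lemma tot_shift {G H : SimpleGraph V} {u : V} (h : ∀ v, v ≠ u → deg H v = deg G v + 1) (k : ℕ) :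
    tot H (k+1) + (if deg G u = k then 1 else 0) = tot G k + (if deg H u = k+1 then 1 else 0) := by
  rw [← tot_succ_split G u, ← tot_succ_split H u]
  have : (Finset.univ.erase u).filter (fun x => deg H x = k+1) = (Finset.univ.erase u).filter (fun x => deg G x = k) := by
    apply Finset.filter_congr
    intro x hx
    rw [h x (Finset.ne_of_mem_erase hx)]; omega
  rw [this]; omega

lemma tot_shift_zero {G H : SimpleGraph V} {u : V} (h : ∀ v, v ≠ u → deg H v = deg G v + 1) :
    tot H 0 = (if deg H u = 0 then 1 else 0) := by
  rw [← tot_succ_split H u]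
  have : (Finset.univ.erase u).filter (fun x => deg H x = 0) = ∅ := by
    apply Finset.filter_false_of_mem
    intro x hx
    rw [h x (Finset.ne_of_mem_erase hx)]; omega
  rw [this]; simp

lemma sum_nb (G : SimpleGraph V) (k : ℕ) : ∑ v, nb G v k = k * tot G k := by
  unfold nb tot
  simp only [Finset.card_filter]
  rw [Finset.sum_comm, Finset.mul_sum]
  apply Finset.sum_congr rfl
  intro x _
  by_cases h : deg G x = k
  · simp only [h, and_true, if_true]
    rw [← Finset.card_filter, ← h, deg_eq_card, mul_one]
    congr 1; ext y; simp [G.adj_comm]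
  · simp [h]

lemma sum_cards (G : SimpleGraph V) (u : V) (k : ℕ) :
    ∑ v ∈ Finset.univ.erase u, ((tot G k : ℤ) - (if deg G v = k then 1 else 0) - nb G v k + nb G v (k+1))
    = ((Fintype.card V : ℤ) - 2 - k) * tot G k + (if deg G u = k then 1 else 0) + nb G u k
      + (k+1) * tot G (k+1) - nb G u (k+1) := by
  have := Finset.add_sum_erase Finset.univ (fun v : V => ((tot G k : ℤ) - (if deg G v = k then 1 else 0) - nb G v k + nb G v (k+1))) (Finset.mem_univ u)
  have h1 := sum_nb G k
  have h2 := sum_nb G (k+1)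
  zify at h1 h2
  have hs : ∑ v : V, ((tot G k : ℤ) - (if deg G v = k then 1 else 0) - nb G v k + nb G v (k+1))
      = (Fintype.card V : ℤ) * tot G k - tot G k - k * tot G k + (k+1) * tot G (k+1) := by
    rw [Finset.sum_add_distrib, Finset.sum_sub_distrib, Finset.sum_sub_distrib, h1, h2,
      Finset.sum_boole, Finset.sum_const, Finset.card_univ, nsmul_eq_mul]
    rfl
  rw [hs] at this
  linarith

lemma deg_lt (G : SimpleGraph V) (v : V) : deg G v < Fintype.card V := by
  rw [deg_eq_card, ← Finset.card_univ]
  apply Finset.card_lt_card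
  rw [Finset.ssubset_univ_iff]
  intro h
  have : v ∈ Finset.univ.filter (fun x : V => G.Adj v x) := by rw [h]; simp
  simp at this

lemma tot_big (G : SimpleGraph V) (k : ℕ) (h : Fintype.card V ≤ k) : tot G k = 0 := by
  unfold tot
  rw [Finset.card_eq_zero]
  apply Finset.filter_false_of_mem
  intro x _
  have := deg_lt G x
  omega

lemma nb_sum_le (G : SimpleGraph V) (v : V) (i j k : ℕ) (hij : i ≠ j) (hik : i ≠ k) (hjk : j ≠ k) :
    nb G v i + nb G v j + nb G v k ≤ deg G v := by
  rw [deg_eq_card]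
  unfold nb
  simp only [Finset.card_filter]
  rw [← Finset.sum_add_distrib, ← Finset.sum_add_distrib]
  apply Finset.sum_le_sum
  intro x _
  by_cases h : G.Adj v x
  · simp only [h, true_and, if_true]; split_ifs <;> omega
  · simp [h]

lemma nb_le_tot (G : SimpleGraph V) (v : V) (k : ℕ) :
    nb G v k + (if deg G v = k then 1 else 0) ≤ tot G k := by
  rw [← tot_succ_split G v]
  apply Nat.add_le_add_right
  apply Finset.card_le_card
  intro x hx
  simp only [Finset.mem_filter, Finset.mem_univ, true_and, Finset.mem_erase, and_true] at hx ⊢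
  exact ⟨hx.1.ne', hx.2⟩

lemma compl_deg (G : SimpleGraph V) (v : V) :
    (Finset.univ.filter (fun x => x ≠ v ∧ ¬ G.Adj v x)).card + deg G v + 1 = Fintype.card V := by
  rw [deg_eq_card]
  have h := Finset.card_filter_add_card_filter_not (s := Finset.univ.erase v) (fun x => G.Adj v x)
  rw [Finset.card_erase_of_mem (Finset.mem_univ v), Finset.card_univ] at h
  have h1 : (Finset.univ.erase v).filter (fun x => G.Adj v x) = Finset.univ.filter (fun x => G.Adj v x) := by
    ext x; simp only [Finset.mem_filter, Finset.mem_erase, Finset.mem_univ, true_and, and_true]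
    exact ⟨fun h => h.2, fun h => ⟨h.ne', h⟩⟩
  have h2 : (Finset.univ.erase v).filter (fun x => ¬ G.Adj v x) = Finset.univ.filter (fun x => x ≠ v ∧ ¬ G.Adj v x) := by
    ext x; simp
  rw [h1, h2] at h
  have hpos : 1 ≤ Fintype.card V := Fintype.card_pos_iff.2 ⟨v⟩
  omega

/-- non-neighbours -/
lemma nonnb_sum_le (G : SimpleGraph V) (v : V) (i j : ℕ) (hij : i ≠ j) :
    tot G i + tot G j + deg G v + 1 ≤ Fintype.card V + nb G v i + nb G v j
      + (if deg G v = i then 1 else 0) + (if deg G v = j then 1 else 0) := by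
  rw [← compl_deg G v, ← tot_succ_split G v i, ← tot_succ_split G v j]
  have : ((Finset.univ.erase v).filter (fun x => deg G x = i)).card +
      ((Finset.univ.erase v).filter (fun x => deg G x = j)).card ≤
      (Finset.univ.filter (fun x => x ≠ v ∧ ¬ G.Adj v x)).card + nb G v i + nb G v j := by
    unfold nb
    rw [← Finset.filter_ne']
    simp only [Finset.card_filter, Finset.filter_filter]
    rw [← Finset.sum_add_distrib, ← Finset.sum_add_distrib, ← Finset.sum_add_distrib]
    apply Finset.sum_le_sum
    intro x _
    by_cases h : G.Adj v x
    · simp only [h, true_and, not_true, and_false, if_false]; split_ifs <;> omega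
    · by_cases hx : x = v
      · simp [hx]
      · simp only [h, hx, false_and, if_false, not_false_eq_true, and_true, true_and, ne_eq, if_true]
        split_ifs <;> omega
  omega

end cards


section myrvold
open Classical
variable {V : Type*} [Fintype V]

lemma nb_zero (G : SimpleGraph V) (v : V) : nb G v 0 = 0 := by
  unfold nb
  rw [Finset.card_eq_zero, Finset.filter_eq_empty_iff]
  rintro x - ⟨h1, h2⟩
  rw [deg_eq_card, Finset.card_eq_zero, Finset.filter_eq_empty_iff] at h2
  exact h2 (Finset.mem_univ v) h1.symm

lemma nb_top (G : SimpleGraph V) (v : V) (N : ℕ) (hN : Fintype.card V = N + 1) :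
    nb G v N + (if deg G v = N then 1 else 0) = tot G N := by
  rw [← tot_succ_split G v]
  congr 1
  unfold nb
  congr 1
  ext x
  simp only [Finset.mem_filter, Finset.mem_univ, true_and, Finset.mem_erase, and_true]
  constructor
  · rintro ⟨h, h'⟩; exact ⟨h.ne', h'⟩
  · rintro ⟨h, h'⟩
    refine ⟨?_, h'⟩
    by_contra hna
    have := compl_deg G x
    rw [h', hN] at this
    have h0 : (Finset.univ.filter (fun y => y ≠ x ∧ ¬ G.Adj x y)).card = 0 := by omega
    rw [Finset.card_eq_zero, Finset.filter_eq_empty_iff] at h0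
    exact h0 (Finset.mem_univ v) ⟨h.symm, fun h => hna h.symm⟩

lemma nb_one_le (G : SimpleGraph V) (v : V) (i : ℕ) : nb G v i ≤ deg G v := by
  have := nb_sum_le G v i (i+1) (i+2) (by omega) (by omega) (by omega)
  omega

lemma nb_two_le (G : SimpleGraph V) (v : V) (i j : ℕ) (h : i ≠ j) : nb G v i + nb G v j ≤ deg G v := by
  have := nb_sum_le G v i j (i+j+1) (by omega) (by omega) (by omega)
  omega

lemma myrvold_eq {G H : SimpleGraph V} {u : V}
    (hc : ∀ v, v ≠ u → Nonempty (gcard G v ≃g gcard H v)) (k : ℕ) :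
    ((Fintype.card V : ℤ) - 2 - k) * tot G k + (if deg G u = k then 1 else 0) + nb G u k
      + (k+1) * tot G (k+1) - nb G u (k+1)
    = ((Fintype.card V : ℤ) - 2 - k) * tot H k + (if deg H u = k then 1 else 0) + nb H u k
      + (k+1) * tot H (k+1) - nb H u (k+1) := by
  rw [← sum_cards, ← sum_cards]
  exact Finset.sum_congr rfl (fun v hv => card_degree_count (hc v (Finset.ne_of_mem_erase hv)) k)

lemma exists_of_tot {G : SimpleGraph V} {k : ℕ} (h : tot G k ≠ 0) : ∃ l, deg G l = k := by
  unfold tot at h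
  obtain ⟨l, hl⟩ := Finset.card_pos.1 (Nat.pos_of_ne_zero h)
  exact ⟨l, by simpa using hl⟩

lemma exists_of_nb {G : SimpleGraph V} {v : V} {k : ℕ} (h : nb G v k ≠ 0) : ∃ l, G.Adj v l ∧ deg G l = k := by
  unfold nb at h
  obtain ⟨l, hl⟩ := Finset.card_pos.1 (Nat.pos_of_ne_zero h)
  exact ⟨l, by simpa using hl⟩

lemma nb_pos {G : SimpleGraph V} {v l : V} (h : G.Adj v l) : nb G v (deg G l) ≠ 0 := by
  unfold nb
  apply Nat.pos_iff_ne_zero.1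
  apply Finset.card_pos.2
  exact ⟨l, by simpa using h⟩

lemma eq_of_tot_one {G : SimpleGraph V} {k : ℕ} (h : tot G k = 1) {x y : V} (hx : deg G x = k)
    (hy : deg G y = k) : x = y := by
  unfold tot at h
  exact Finset.card_le_one.1 h.le x (by simpa using hx) y (by simpa using hy)

lemma myrvold_zero {G H : SimpleGraph V} {u : V} (hn : 7 ≤ Fintype.card V)
    (hc : ∀ v, v ≠ u → Nonempty (gcard G v ≃g gcard H v))
    (hs : ∀ v, v ≠ u → deg H v = deg G v + 1) (hd : deg H u = 0)
    (hD : deg G u + 3 = Fintype.card V) : False := by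
  have hE := myrvold_eq hc 0
  have h1 := tot_shift_zero hs
  have h2 := tot_shift hs 0
  have h3 := nb_two_le H u 0 1 (by omega)
  have h4 := nonnb_sum_le G u 0 1 (by omega)
  have h5 := nb_zero G u
  have h6 := nb_le_tot G u 0
  have h7 := nb_le_tot G u 1
  generalize Fintype.card V = n at *
  have e0 : deg G u ≠ 0 := by omega
  have e1 : deg G u ≠ 1 := by omega
  simp only [hd, e0, e1, if_true, if_false, zero_add] at *
  have e2 : nb H u 0 = 0 := by omega
  have e3 : nb H u 1 = 0 := by omega
  simp only [h1, h5, e2, e3] at *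
  norm_num at hE h2
  rw [h2] at hE
  have b : tot G 0 = 0 ∨ tot G 0 = 1 ∨ tot G 0 = 2 := by omega
  rcases b with b | b | b <;> rw [b] at hE <;> omega

lemma myrvold_two {G H : SimpleGraph V} {u : V} (N : ℕ) (hn : 5 ≤ N) (hN : Fintype.card V = N + 2)
    (hc : ∀ v, v ≠ u → Nonempty (gcard G v ≃g gcard H v))
    (hs : ∀ v, v ≠ u → deg H v = deg G v + 1) (hd : deg H u = 2)
    (hD : deg G u = N + 1) : False := by
  have hE := myrvold_eq hc N
  have h1 := tot_shift hs N
  have h2 := tot_shift hs (N+1)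
  have h3 := tot_big H (N+1+1) (by omega)
  have h4 := nonnb_sum_le G u N (N+1) (by omega)
  have h5 := nb_two_le H u N (N+1) (by omega)
  have h6 := nb_le_tot G u N
  have h7 := nb_le_tot G u (N+1)
  have h8 := nb_top H u (N+1) hN
  have cn0 : ((Fintype.card V : ℕ) : ℤ) - 2 = N := by rw [hN]; push_cast; ring
  rw [cn0] at hE
  rw [hN] at h4
  have e0 : ¬ (2 = N) := by omega
  have e1 : ¬ (2 = N + 1) := by omega
  have e2 : ¬ (2 = N + 1 + 1) := by omega
  have e3 : ¬ (N + 1 = N) := by omega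
  simp only [hd, hD, e0, e1, e2, e3, if_true, if_false, add_zero] at *
  have a1 : tot G (N+1) = 1 := by omega
  have a2 : nb G u (N+1) = 0 := by omega
  have a3 : nb G u N = tot G N := by omega
  rw [a1, a2, a3, h8, h1] at hE
  push_cast at hE
  simp only [sub_self, zero_mul, mul_zero, zero_add, add_zero, sub_zero] at hE
  have hq : nb H u (N+1) ≤ 2 := by omega
  have b : tot G N = 0 ∨ tot G N = 1 ∨ tot G N = 2 := by omega
  rcases b with b | b | b <;> rw [b] at hE <;> push_cast at hE <;> omega

lemma myrvold_one {G H : SimpleGraph V} {u : V} (N : ℕ) (hn : 5 ≤ N) (hN : Fintype.card V = N + 2)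
    (hc : ∀ v, v ≠ u → Nonempty (gcard G v ≃g gcard H v))
    (hs : ∀ v, v ≠ u → deg H v = deg G v + 1) (hd : deg H u = 1)
    (hD : deg G u = N) : False := by
  have cn0 : ((Fintype.card V : ℕ) : ℤ) - 2 = N := by rw [hN]; push_cast; ring
  -- basic
  have s0 := tot_shift_zero hs
  have sh : ∀ k, k ≠ 0 → k ≠ N → tot H (k+1) = tot G k := by
    intro k h0 h1
    have := tot_shift hs k
    rw [hd, hD, if_neg (by omega), if_neg (by omega)] at this
    simpa using this
  have s1 : tot H 1 = tot G 0 + 1 := by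
    have := tot_shift hs 0
    rw [hd, hD, if_neg (by omega), if_pos (by omega)] at this
    simpa using this
  have sN : tot H (N+1) + 1 = tot G N := by
    have := tot_shift hs N
    rw [hd, hD, if_pos (by omega), if_neg (by omega)] at this
    simpa using this
  rw [hd, if_neg (by omega)] at s0
  have g0 := nb_zero G u
  have q0 := nb_zero H u
  have E0 := myrvold_eq hc 0
  rw [cn0, hd, hD, if_neg (by omega), if_neg (by omega), s0, s1, g0, q0] at E0
  push_cast at E0
  have n1 := nb_le_tot G u 1
  have n1' := nb_le_tot H u 1
  rw [hD, if_neg (by omega)] at n1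
  rw [hd, if_pos rfl, s1] at n1'
  have b0 : tot G 0 = 0 := by
    by_contra hb
    have : (1:ℤ) ≤ tot G 0 := by omega
    have hN5 : (5:ℤ) ≤ N := by omega
    simp only [zero_add, add_zero, sub_zero, one_mul, mul_zero, Nat.cast_zero] at E0
    nlinarith
  have p1 : nb H u 1 = 0 := by omega
  rw [b0, p1] at E0
  simp only [zero_add, add_zero, sub_zero, one_mul, mul_zero, Nat.cast_zero] at E0
  have m1 : tot G 1 = nb G u 1 + 1 := by omega
  have mj : ∀ j, j ≠ 1 → j ≠ N → nb G u j = tot G j := by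
    intro j h1 h2
    have h3 := nonnb_sum_le G u 1 j (by omega)
    have h4 := nb_le_tot G u j
    rw [hD, if_neg (by omega), if_neg (by omega), hN] at h3
    rw [hD, if_neg (by omega)] at h4
    omega
  have mN : nb G u N + 1 = tot G N := by
    have h3 := nonnb_sum_le G u 1 N (by omega)
    have h4 := nb_le_tot G u N
    rw [hD, if_neg (by omega), if_pos rfl, hN] at h3
    rw [hD, if_pos rfl] at h4
    omega
  have tG : tot G (N+1) = 0 := by
    rw [← sh (N+1) (by omega) (by omega)]
    exact tot_big H _ (by omega)
  have qG : nb G u (N+1) = 0 := by rw [mj _ (by omega) (by omega), tG]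
  have qt := nb_top H u (N+1) hN
  rw [hd, if_neg (by omega)] at qt
  have EN := myrvold_eq hc N
  rw [cn0, hd, hD, if_pos rfl, if_neg (by omega), tG, qG] at EN
  push_cast at EN
  simp only [sub_self, zero_mul, mul_zero, zero_add, add_zero, sub_zero] at EN
  have hQ : tot H (N+1) = 0 := by
    by_contra hb
    have hle := nb_two_le H u N (N+1) (by omega)
    have h1 : tot H (N+1) = 1 := by omega
    rw [h1] at EN
    push_cast at EN
    omega
  have pN : nb H u N = 1 := by
    rw [hQ] at EN
    simp only [Nat.cast_zero, mul_zero] at EN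
    omega
  have pj : ∀ j, j ≠ N → nb H u j = 0 := by
    intro j hj
    have := nb_two_le H u N j (by omega)
    omega
  have E1 := myrvold_eq hc 1
  rw [cn0, hd, hD, if_neg (by omega), if_pos rfl, s1, b0, sh 1 (by omega) (by omega), p1,
    pj 2 (by omega), mj 2 (by omega) (by omega)] at E1
  have E2 := myrvold_eq hc 2
  rw [cn0, hd, hD, if_neg (by omega), if_neg (by omega), sh 1 (by omega) (by omega),
    sh 2 (by omega) (by omega), pj 2 (by omega), pj (2+1) (by omega), mj 2 (by omega) (by omega),
    mj (2+1) (by omega) (by omega)] at E2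
  push_cast at E1 E2
  norm_num at E1 E2
  have hN5 : (5:ℤ) ≤ N := by omega
  have hb1 : tot G 1 ≤ 2 := by
    by_contra hb
    have : (3:ℤ) ≤ tot G 1 := by omega
    have : (tot G 1 : ℤ) = nb G u 1 + 1 := by omega
    have : (0:ℤ) ≤ tot G 2 := by omega
    nlinarith
  have hcase : N = 5 ∧ ((tot G 1 = 1 ∧ tot G 2 = 3 ∧ tot G 3 = 0) ∨ (tot G 1 = 2 ∧ tot G 2 = 0 ∧ tot G 3 = 3)) := by
    have : (tot G 1 : ℤ) = nb G u 1 + 1 := by omega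
    have b : tot G 1 = 1 ∨ tot G 1 = 2 := by omega
    rcases b with b | b
    · rw [b] at E1 E2
      have c : tot G 2 = 3 := by push_cast at E1; omega
      rw [c] at E2
      push_cast at E2
      omega
    · rw [b] at E1 E2
      have c : N = 5 ∧ tot G 2 = 0 := by push_cast at E1; omega
      rw [c.2, c.1] at E2
      push_cast at E2
      omega
  obtain ⟨rfl, hcase⟩ := hcase
  have E3 := myrvold_eq hc 3
  rw [cn0, hd, hD, if_neg (by omega), if_neg (by omega), sh 2 (by omega) (by omega),
    sh 3 (by omega) (by omega), pj 3 (by omega), pj (3+1) (by omega), mj 3 (by omega) (by omega),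
    mj (3+1) (by omega) (by omega)] at E3
  norm_num at E3
  have t5 : tot G 5 = 1 := by omega
  have t6 := tG
  have t6' := hQ
  have sh4 := sh 4 (by omega) (by omega)
  have sh3 := sh 3 (by omega) (by omega)
  have sh2 := sh 2 (by omega) (by omega)
  have sh1 := sh 1 (by omega) (by omega)
  norm_num at t6 t6' sh4 sh3 sh2 sh1
  rcases hcase with ⟨b1, b2, b3⟩ | ⟨b1, b2, b3⟩
  · obtain ⟨l, hl⟩ := exists_of_tot (G := G) (k := 1) (by omega)
    have hlu : l ≠ u := by rintro rfl; omega
    have hna : ¬ G.Adj u l := by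
      intro h
      have := nb_pos h
      rw [hl] at this; omega
    have n5 : nb G l 5 = 0 := by
      by_contra h
      obtain ⟨x, hx, hx5⟩ := exists_of_nb h
      rw [eq_of_tot_one t5 hx5 hD] at hx
      exact hna hx.symm
    have hl' := hs l hlu
    have C5 := card_degree_count (hc l hlu) 5
    have C3 := card_degree_count (hc l hlu) 3
    have i1 := nb_le_tot G l 6
    have i2 := nb_le_tot H l 6
    have i3 := nb_le_tot G l 3
    have i4 := nb_two_le H l 3 5 (by omega)
    have i5 := nb_one_le G l 4
    rw [hl', hl, if_neg (by omega), if_neg (by omega)] at C5 C3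
    norm_num at C5 C3
    omega
  · obtain ⟨l, hadj, hl⟩ := exists_of_nb (G := G) (v := u) (k := 1) (by omega)
    have hlu : l ≠ u := hadj.ne'
    have n5 : nb G l 5 ≠ 0 := by
      have := nb_pos hadj.symm
      rwa [hD] at this
    have hl' := hs l hlu
    have C5 := card_degree_count (hc l hlu) 5
    have C2 := card_degree_count (hc l hlu) 2
    have C1 := card_degree_count (hc l hlu) 1
    have i1 := nb_le_tot G l 6
    have i2 := nb_le_tot H l 6
    have j1 := nb_two_le G l 1 5 (by omega)
    have j2 := nb_two_le G l 2 5 (by omega)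
    have j3 := nb_two_le G l 3 5 (by omega)
    have i4 := nb_sum_le H l 1 2 5 (by omega) (by omega) (by omega)
    rw [hl', hl] at C5 C2 C1
    norm_num at C5 C2 C1
    omega

lemma myrvold_aux {G H : SimpleGraph V} {u : V} (hn : 7 ≤ Fintype.card V)
    (hc : ∀ v, v ≠ u → Nonempty (gcard G v ≃g gcard H v)) (h : kappa G 2 < kappa H 2) : False := by
  have h1 := missing_rel hc 2
  rw [degR_two, degR_two] at h1
  have h2 : ∀ v, v ≠ u → (deg H v : ℤ) = deg G v + ((kappa H 2 : ℤ) - kappa G 2) := by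
    intro v hv
    have := card_kappa_rel (hc v hv) 2
    rwa [degR_two, degR_two] at this
  have h3 := deg_lt G u
  have hd1 : (kappa H 2 : ℤ) - kappa G 2 = 1 := by
    by_contra hne
    have : (2:ℤ) ≤ (kappa H 2 : ℤ) - kappa G 2 := by omega
    have h7 : (7:ℤ) ≤ Fintype.card V := by exact_mod_cast hn
    have : (deg G u : ℤ) < Fintype.card V := by exact_mod_cast h3
    push_cast at h1
    nlinarith
  rw [hd1] at h1 h2
  have hs : ∀ v, v ≠ u → deg H v = deg G v + 1 := fun v hv => by exact_mod_cast h2 v hv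
  push_cast at h1
  have hd : deg H u = 0 ∨ deg H u = 1 ∨ deg H u = 2 := by omega
  rcases hd with hd | hd | hd
  · exact myrvold_zero hn hc hs hd (by omega)
  · exact myrvold_one (Fintype.card V - 2) (by omega) (by omega) hc hs hd (by omega)
  · exact myrvold_two (Fintype.card V - 2) (by omega) (by omega) hc hs hd (by omega)

lemma myrvold {G H : SimpleGraph V} {u : V} (hn : 7 ≤ Fintype.card V)
    (hc : ∀ v, v ≠ u → Nonempty (gcard G v ≃g gcard H v)) : kappa G 2 = kappa H 2 := by
  rcases lt_trichotomy (kappa G 2) (kappa H 2) with h | h | h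
  · exact (myrvold_aux hn hc h).elim
  · exact h
  · exact (myrvold_aux hn (fun v hv => (hc v hv).map Iso.symm) h).elim

lemma deg_same {G H : SimpleGraph V} {u : V} (hn : 7 ≤ Fintype.card V)
    (hc : ∀ v, v ≠ u → Nonempty (gcard G v ≃g gcard H v)) (v : V) : deg H v = deg G v := by
  have h0 := myrvold hn hc
  by_cases hv : v = u
  · have h1 := missing_rel hc 2
    rw [degR_two, degR_two, h0, sub_self, mul_zero] at h1
    rw [hv]; omega
  · have := card_kappa_rel (hc v hv) 2
    rw [degR_two, degR_two] at this
    omega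

end myrvold


section mainarg
open Classical
variable {V : Type*} [Fintype V]

/-- non-neighbours of `v` inside `S` -/
noncomputable def AA (G : SimpleGraph V) (S : Finset V) (v : V) : Finset V :=
  S.filter (fun x => x ≠ v ∧ ¬ G.Adj v x)

lemma mem_AA {G : SimpleGraph V} {S : Finset V} {v x : V} :
    x ∈ AA G S v ↔ x ∈ S ∧ x ≠ v ∧ ¬ G.Adj v x := by
  simp [AA]

lemma AA_subset (G : SimpleGraph V) (S : Finset V) (v : V) : AA G S v ⊆ S := Finset.filter_subset _ _

lemma AA_sub_compl (G : SimpleGraph V) (S : Finset V) (v : V) :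
    AA G S v ⊆ Finset.univ.filter (fun x => x ≠ v ∧ ¬ G.Adj v x) := by
  intro x hx
  rw [mem_AA] at hx
  simpa using hx.2

lemma card_AA_le {G : SimpleGraph V} {S : Finset V} {v : V} {N : ℕ}
    (h : N + deg G v + 1 = Fintype.card V) : (AA G S v).card ≤ N := by
  have h1 := Finset.card_le_card (AA_sub_compl G S v)
  have h2 := compl_deg G v
  omega

/-- F3 -/
lemma AA_sum_eq {G H : SimpleGraph V} {v : V} (h : Nonempty (gcard G v ≃g gcard H v))
    (S : Finset V) (D : ℕ) (hG : ∀ x, deg G x ≤ D) (hH : ∀ x, deg H x ≤ D)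
    (hSG : ∀ x, x ∈ S ↔ deg G x = D) (hSH : ∀ x, x ∈ S ↔ deg H x = D) (F : (ℕ → ℕ) → ℤ) :
    ∑ x ∈ AA G S v, F (fun s => degR G s x) = ∑ x ∈ AA H S v, F (fun s => degR H s x) := by
  have key : ∀ G : SimpleGraph V, (∀ x, deg G x ≤ D) → (∀ x, x ∈ S ↔ deg G x = D) →
      ∑ x : {x : V // x ≠ v}, (if deg (gcard G v) x = D then F (fun s => degR (gcard G v) s x) else 0)
      = ∑ x ∈ AA G S v, F (fun s => degR G s x) := by
    intro G hG hS
    let f : V → ℤ := fun x => if x ∈ S ∧ ¬ G.Adj v x then F (fun s => degR G s x) else 0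
    have e : ∀ x : {x : V // x ≠ v},
        (if deg (gcard G v) x = D then F (fun s => degR (gcard G v) s x) else 0) = f x.1 := by
      intro x
      have h1 := deg_gcard G v x
      have h2 := hG x
      simp only [f]
      by_cases ha : G.Adj v x
      · rw [if_pos ha] at h1
        rw [if_neg (by omega), if_neg (by tauto)]
      · rw [if_neg ha] at h1
        have h3 : (fun s => degR (gcard G v) s x) = fun s => degR G s x := by
          funext s; exact degR_gcard G v s x ha
        rw [h3]
        simp only [ha, hS, not_false_eq_true, and_true]
        rw [← h1, add_zero]
    rw [sum_ne v _ f e]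
    simp only [f]
    rw [← Finset.sum_filter]
    apply Finset.sum_congr _ (fun _ _ => rfl)
    ext x
    simp only [mem_AA, Finset.mem_filter, Finset.mem_erase, Finset.mem_univ, and_true]
    tauto
  rw [← key G hG hSG, ← key H hH hSH]
  exact card_sum h (fun d f => if d = D then F f else 0)

lemma AA_swap (G : SimpleGraph V) (S : Finset V) (N : ℕ)
    (hN : ∀ x ∈ S, N + deg G x + 1 = Fintype.card V) (f : V → ℤ) :
    ∑ v, ∑ x ∈ AA G S v, f x = N * ∑ x ∈ S, f x := by
  simp only [AA, Finset.sum_filter]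
  rw [Finset.sum_comm, Finset.mul_sum]
  apply Finset.sum_congr rfl
  intro x hx
  rw [← Finset.sum_filter, Finset.sum_const, nsmul_eq_mul]
  have h1 := compl_deg G x
  have h2 := hN x hx
  have h3 : Finset.univ.filter (fun v => x ≠ v ∧ ¬ G.Adj v x) = Finset.univ.filter (fun y => y ≠ x ∧ ¬ G.Adj x y) := by
    apply Finset.filter_congr
    intro y _
    rw [G.adj_comm, ne_comm]
  rw [h3]
  congr 2
  omega

lemma AA_swapS (G : SimpleGraph V) (S : Finset V) (f : V → ℤ) :
    ∑ v ∈ S, ∑ x ∈ AA G S v, f x = ∑ x ∈ S, (AA G S x).card * f x := by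
  simp only [AA, Finset.sum_filter]
  rw [Finset.sum_comm]
  apply Finset.sum_congr rfl
  intro x hx
  rw [← Finset.sum_filter, Finset.sum_const, nsmul_eq_mul]
  congr 3
  apply Finset.filter_congr
  intro y _
  rw [G.adj_comm, ne_comm]

lemma dich {P : Type*} (S AG AH : Finset V) (N : ℕ) (vG vH : V → P)
    (K : ∀ F : P → ℤ, N * ∑ x ∈ S, F (vG x) - ∑ x ∈ AG, F (vG x) = N * ∑ x ∈ S, F (vH x) - ∑ x ∈ AH, F (vH x))
    (hAG : AG.card ≤ N) (hne : S.val.map vG ≠ S.val.map vH) :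
    AG.card = N ∧ ∃ p, ∀ x ∈ AG, vG x = p := by
  have h1 : ¬ (S.val.map vG ≤ S.val.map vH) := by
    intro h
    exact hne (Multiset.eq_of_le_of_card_le h (by simp))
  rw [Multiset.le_iff_count] at h1
  push Not at h1
  obtain ⟨p, hp⟩ := h1
  have hcount : ∀ v : V → P, (Multiset.count p (S.val.map v) : ℤ) = ∑ x ∈ S, (if v x = p then (1:ℤ) else 0) := by
    intro v
    rw [Finset.sum_boole, Multiset.count_map]
    simp [Finset.card, eq_comm]
  have hK := K (fun a => if a = p then 1 else 0)
  rw [← hcount, ← hcount, Finset.sum_boole, Finset.sum_boole] at hK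
  have h2 : (AG.filter (fun x => vG x = p)).card ≤ AG.card := Finset.card_filter_le _ _
  have h3 : (N : ℤ) ≤ (AG.filter (fun x => vG x = p)).card := by
    have : (1:ℤ) ≤ (Multiset.count p (S.val.map vG) : ℤ) - Multiset.count p (S.val.map vH) := by omega
    have hN : (0:ℤ) ≤ N := by omega
    have h4 : (0:ℤ) ≤ (AH.filter (fun x => vH x = p)).card := by omega
    nlinarith
  refine ⟨by omega, p, ?_⟩
  have h5 : AG.filter (fun x => vG x = p) = AG := Finset.eq_of_subset_of_card_le (Finset.filter_subset _ _) (by omega)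
  intro x hx
  rw [← h5] at hx
  exact (Finset.mem_filter.1 hx).2

/-- standing hypotheses -/
structure Setup (G H : SimpleGraph V) (u : V) (S : Finset V) (D N : ℕ) : Prop where
  hc : ∀ v, v ≠ u → Nonempty (gcard G v ≃g gcard H v)
  hG : ∀ x, deg G x ≤ D
  hH : ∀ x, deg H x ≤ D
  hSG : ∀ x, x ∈ S ↔ deg G x = D
  hSH : ∀ x, x ∈ S ↔ deg H x = D
  hN : N + D + 1 = Fintype.card V
  hne : S.Nonempty

lemma Setup.symm {G H : SimpleGraph V} {u : V} {S : Finset V} {D N : ℕ} (h : Setup G H u S D N) :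
    Setup H G u S D N :=
  ⟨fun v hv => (h.hc v hv).map Iso.symm, h.hH, h.hG, h.hSH, h.hSG, h.hN, h.hne⟩

lemma Setup.NG {G H : SimpleGraph V} {u : V} {S : Finset V} {D N : ℕ} (h : Setup G H u S D N) :
    ∀ x ∈ S, N + deg G x + 1 = Fintype.card V := by
  intro x hx
  rw [(h.hSG x).1 hx]; exact h.hN

lemma Setup.K {G H : SimpleGraph V} {u : V} {S : Finset V} {D N : ℕ} (h : Setup G H u S D N)
    (F : (ℕ → ℕ) → ℤ) :
    N * ∑ x ∈ S, F (fun s => degR G s x) - ∑ x ∈ AA G S u, F (fun s => degR G s x)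
    = N * ∑ x ∈ S, F (fun s => degR H s x) - ∑ x ∈ AA H S u, F (fun s => degR H s x) := by
  rw [← AA_swap G S N h.NG, ← AA_swap H S N h.symm.NG]
  rw [← Finset.add_sum_erase _ _ (Finset.mem_univ u), ← Finset.add_sum_erase _ (fun v => ∑ x ∈ AA H S v, F (fun s => degR H s x)) (Finset.mem_univ u)]
  rw [add_sub_cancel_left, add_sub_cancel_left]
  exact Finset.sum_congr rfl (fun v hv => AA_sum_eq (h.hc v (Finset.ne_of_mem_erase hv)) S D h.hG h.hH h.hSG h.hSH F)

/-- unique nonneighbour -/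
lemma leaf_of {G H : SimpleGraph V} {u : V} {S : Finset V} {D : ℕ} (h : Setup G H u S D 1)
    {x y : V} (hx : x ∈ S) (hxy : y ≠ x) (hn : ¬ G.Adj x y) : ∀ z, z ≠ x → z ≠ y → G.Adj x z := by
  have h1 := compl_deg G x
  have h2 := h.NG x hx
  have h3 : (Finset.univ.filter (fun y => y ≠ x ∧ ¬ G.Adj x y)).card ≤ 1 := by omega
  intro z hz hzy
  by_contra hna
  exact hzy (Finset.card_le_one.1 h3 z (by simp [hz, hna]) y (by simp [hxy, hn]))

lemma case_out {G H : SimpleGraph V} {u : V} {S : Finset V} {D N : ℕ} (h : Setup G H u S D N)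
    (hu : u ∉ S) (hN : 1 ≤ N) (r : ℕ) (hr : kappa G r ≠ kappa H r) : False := by
  have hS : ∀ x ∈ S, x ≠ u := fun x hx hxu => hu (hxu ▸ hx)
  by_cases hN1 : N = 1
  · subst hN1
    have hex : ∃ s, kappa G s ≠ kappa H s := ⟨r, hr⟩
    let r0 := Nat.find hex
    have hr0 : kappa G r0 ≠ kappa H r0 := Nat.find_spec hex
    have hmin : ∀ s, s < r0 → kappa G s = kappa H s := fun s hs => not_not.1 (Nat.find_min hex hs)
    have hrec : ∀ s, s ≤ r0 → ∀ x ∈ AA G S u, ∀ y ∈ AA H S u, degR G s x = degR H s y := by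
      intro s
      induction s with
      | zero => intros; rw [degR_zero, degR_zero]
      | succ s ih =>
        intro hs x hx y hy
        have i := ih (by omega) x hx y hy
        rw [mem_AA] at hx hy
        have hx' : ¬ G.Adj x u := fun h => hx.2.2 h.symm
        have hy' : ¬ H.Adj y u := fun h => hy.2.2 h.symm
        have e1 := degR_leaf G s x u hx.2.1 hx' (leaf_of h hx.1 hx.2.1.symm hx')
        have e2 := degR_leaf H s y u hy.2.1 hy' (leaf_of h.symm hy.1 hy.2.1.symm hy')
        have e3 := hmin s (by omega)
        have e4 := missing_rel h.hc s
        rw [e3, sub_self, mul_zero] at e4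
        omega
    have K1 := h.K (fun _ => 1)
    have K2 := h.K (fun f => f r0)
    simp only [Finset.sum_const, nsmul_eq_mul, mul_one] at K1
    have hAA : ∑ x ∈ AA G S u, (degR G r0 x : ℤ) = ∑ x ∈ AA H S u, (degR H r0 x : ℤ) := by
      rcases (AA G S u).eq_empty_or_nonempty with he | ⟨x, hx⟩
      · rw [he, Finset.card_empty] at K1
        have : AA H S u = ∅ := by rw [← Finset.card_eq_zero]; omega
        rw [he, this, Finset.sum_empty, Finset.sum_empty]
      · have hcard : (AA G S u).card = (AA H S u).card := by omega
        have hpos : 0 < (AA H S u).card := by rw [← hcard]; exact Finset.card_pos.2 ⟨x, hx⟩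
        obtain ⟨y, hy⟩ := Finset.card_pos.1 hpos
        rw [Finset.sum_congr rfl (g := fun _ => (degR G r0 x : ℤ)) (fun x' hx' => by
          rw [hrec r0 le_rfl x' hx' y hy, hrec r0 le_rfl x hx y hy])]
        rw [Finset.sum_congr rfl (s₁ := AA H S u) (g := fun _ => (degR G r0 x : ℤ)) (fun y' hy' => by
          rw [hrec r0 le_rfl x hx y' hy'])]
        rw [Finset.sum_const, Finset.sum_const, hcard]
    have hSS : ∑ x ∈ S, (degR H r0 x : ℤ) = ∑ x ∈ S, (degR G r0 x : ℤ) + S.card * ((kappa H r0 : ℤ) - kappa G r0) := by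
      rw [Finset.sum_congr rfl (fun x hx => card_kappa_rel (h.hc x (hS x hx)) r0), Finset.sum_add_distrib,
        Finset.sum_const, nsmul_eq_mul]
    simp only [] at K2
    rw [hAA, hSS] at K2
    have h0 : (S.card : ℤ) * ((kappa H r0 : ℤ) - kappa G r0) = 0 := by push_cast at K2; linarith
    rcases mul_eq_zero.1 h0 with h1 | h1
    · have := Finset.card_pos.2 h.hne; omega
    · omega
  · have hN2 : 2 ≤ N := by omega
    obtain ⟨δ, hδ⟩ : ∃ δ : ℤ, δ = (kappa H r : ℤ) - kappa G r := ⟨_, rfl⟩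
    have hδ0 : δ ≠ 0 := by omega
    obtain ⟨x0, hx0, hmax⟩ := Finset.exists_max_image S (fun x => δ * (degR G r x : ℤ)) h.hne
    have hz : ∀ x ∈ S, (degR G r x : ℤ) ≠ degR G r x0 + δ := by
      intro x hx he
      have := hmax x hx
      rw [he] at this
      have : 0 < δ * δ := mul_self_pos.2 hδ0
      nlinarith
    have hK := h.K (fun f => if (f r : ℤ) = degR G r x0 + δ then 1 else 0)
    simp only [] at hK
    rw [Finset.sum_congr rfl (s₁ := S) (g := fun _ => (0:ℤ)) (fun x hx => if_neg (hz x hx)),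
      Finset.sum_congr rfl (s₁ := AA G S u) (g := fun _ => (0:ℤ)) (fun x hx => if_neg (hz x (AA_subset G S u hx)))] at hK
    rw [Finset.sum_boole, Finset.sum_boole] at hK
    simp only [Finset.sum_const_zero, mul_zero, sub_zero] at hK
    have h1 : ((AA H S u).filter (fun x => (degR H r x : ℤ) = degR G r x0 + δ)).card
        ≤ (S.filter (fun x => (degR H r x : ℤ) = degR G r x0 + δ)).card :=
      Finset.card_le_card (Finset.filter_subset_filter _ (AA_subset H S u))
    have h2 : 0 < (S.filter (fun x => (degR H r x : ℤ) = degR G r x0 + δ)).card := by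
      apply Finset.card_pos.2
      refine ⟨x0, Finset.mem_filter.2 ⟨hx0, ?_⟩⟩
      rw [hδ]; exact card_kappa_rel (h.hc x0 (hS x0 hx0)) r
    have h3 : (2:ℤ) ≤ N := by omega
    zify at h1 h2
    nlinarith

end mainarg


section mainarg2
open Classical
variable {V : Type*} [Fintype V]

/-- shift relation for `u ∈ S` -/
lemma Setup.T1 {G H : SimpleGraph V} {u : V} {S : Finset V} {D N : ℕ} (h : Setup G H u S D N)
    (hu : u ∈ S) (r : ℕ) (F : ℤ → ℤ) :
    ∑ x ∈ S, F (degR H r x) - F (degR H r u)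
      = ∑ x ∈ S, F (degR G r x + ((kappa H r : ℤ) - kappa G r)) - F (degR G r u + ((kappa H r : ℤ) - kappa G r)) := by
  rw [← Finset.add_sum_erase _ _ hu, ← Finset.add_sum_erase _ (fun x => F (degR G r x + ((kappa H r : ℤ) - kappa G r))) hu]
  rw [add_sub_cancel_left, add_sub_cancel_left]
  exact Finset.sum_congr rfl (fun v hv => by rw [card_kappa_rel (h.hc v (Finset.ne_of_mem_erase hv)) r])

lemma leaf_eq {G H : SimpleGraph V} {u : V} {S : Finset V} {D : ℕ} (h : Setup G H u S D 1)
    {x y : V} (hx : x ∈ S) (hy : y ∈ S) (hxy : y ≠ x) (hn : ¬ G.Adj x y) (r : ℕ) :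
    degR G r x = degR G r y := by
  cases r with
  | zero => rw [degR_zero, degR_zero]
  | succ s =>
    have hn' : ¬ G.Adj y x := fun h => hn h.symm
    have e1 := degR_leaf G s x y hxy.symm hn (leaf_of h hx hxy hn)
    have e2 := degR_leaf G s y x hxy hn' (leaf_of h hy hxy.symm hn')
    omega

lemma cycle_eq {G H : SimpleGraph V} {u : V} {S : Finset V} {D : ℕ} (h : Setup G H u S D 2)
    (hfull : ∀ v ∈ S, (AA G S v).card = 2)
    {x y : V} (hx : x ∈ S) (hxy : y ≠ x) (hn : ¬ G.Adj x y) (r : ℕ) :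
    degR G r x = degR G r y := by
  refine cycle_lemma G (fun v => v ∈ S) ?_ x y hx hxy.symm hn r
  intro x hx a hax hna
  have h1 := compl_deg G x
  have h2 := h.NG x hx
  have h3 : AA G S x = Finset.univ.filter (fun y => y ≠ x ∧ ¬ G.Adj x y) :=
    Finset.eq_of_subset_of_card_le (AA_sub_compl G S x) (by rw [hfull x hx]; omega)
  have ha : a ∈ AA G S x := by rw [h3]; simp [hax, hna]
  have h4 : ((AA G S x).erase a).card = 1 := by rw [Finset.card_erase_of_mem ha, hfull x hx]
  obtain ⟨b, hb⟩ := Finset.card_eq_one.1 h4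
  have hb' : b ∈ (AA G S x).erase a := by rw [hb]; simp
  rw [Finset.mem_erase, mem_AA] at hb'
  refine ⟨(mem_AA.1 ha).1, b, hb'.1, hb'.2.2.1, ?_⟩
  intro z
  constructor
  · intro hz
    by_cases hzx : z = x
    · exact Or.inl hzx
    · by_cases hza : z = a
      · exact Or.inr (Or.inl hza)
      · have : z ∈ (AA G S x).erase a := by
          rw [Finset.mem_erase, h3]; simp [hza, hzx, hz]
        rw [hb, Finset.mem_singleton] at this
        exact Or.inr (Or.inr this)
  · rintro (rfl | rfl | rfl)
    · exact G.loopless.irrefl _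
    · exact hna
    · exact hb'.2.2.2

lemma case_neq {G H : SimpleGraph V} {u : V} {S : Finset V} {D N : ℕ} (h : Setup G H u S D N)
    (hu : u ∈ S) (hN : 1 ≤ N) (r : ℕ) (hr : kappa G r ≠ kappa H r)
    (hAG : (AA G S u).card = N) (hAH : (AA H S u).card = N)
    (p q : ℤ) (hp : ∀ x ∈ AA G S u, (degR G r x : ℤ) = p) (hq : ∀ x ∈ AA H S u, (degR H r x : ℤ) = q) :
    False := by
  obtain ⟨δ, hδ⟩ : ∃ δ : ℤ, δ = (kappa H r : ℤ) - kappa G r := ⟨_, rfl⟩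
  have hδ0 : δ ≠ 0 := by omega
  have hNz : (N : ℤ) ≠ 0 := by omega
  have E1 : ∀ F : ℤ → ℤ, ∑ x ∈ S, F (degR G r x) - ∑ x ∈ S, F (degR H r x) = F p - F q := by
    intro F
    have hK := h.K (fun f => F (f r))
    rw [Finset.sum_congr rfl (s₁ := AA G S u) (g := fun _ => F p) (fun x hx => by rw [hp x hx]),
      Finset.sum_congr rfl (s₁ := AA H S u) (g := fun _ => F q) (fun x hx => by rw [hq x hx]),
      Finset.sum_const, Finset.sum_const, hAG, hAH, nsmul_eq_mul, nsmul_eq_mul] at hK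
    apply mul_left_cancel₀ hNz
    linarith
  have T1 := h.T1 hu r
  rw [← hδ] at T1
  have hid : δ * S.card = degR G r u + δ - degR H r u + q - p := by
    have e1 := E1 id
    have t1 := T1 id
    simp only [id] at e1 t1
    rw [Finset.sum_add_distrib, Finset.sum_const, nsmul_eq_mul] at t1
    linarith
  have hfin : (degR G r u : ℤ) = p → (degR H r u : ℤ) = q → False := by
    intro h1 h2
    have h3 : δ * ((S.card : ℤ) - 1) = 0 := by rw [mul_sub, hid]; linarith
    have h4 : S.card = 1 := by
      rcases mul_eq_zero.1 h3 with h | h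
      · exact (hδ0 h).elim
      · omega
    obtain ⟨a, ha⟩ := Finset.card_pos.1 (by omega : 0 < (AA G S u).card)
    rw [mem_AA] at ha
    exact ha.2.1 (Finset.card_le_one.1 h4.le a ha.1 u hu)
  obtain ⟨a, ha⟩ := Finset.card_pos.1 (by omega : 0 < (AA G S u).card)
  obtain ⟨b, hb⟩ := Finset.card_pos.1 (by omega : 0 < (AA H S u).card)
  have hpa := hp a ha
  have hqb := hq b hb
  have ha' := mem_AA.1 ha
  have hb' := mem_AA.1 hb
  by_cases hN1 : N = 1
  · subst hN1
    apply hfin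
    · rw [← hpa, leaf_eq h hu ha'.1 ha'.2.1 ha'.2.2 r]
    · rw [← hqb, leaf_eq h.symm hu hb'.1 hb'.2.1 hb'.2.2 r]
  by_cases hN2 : N = 2
  · subst hN2
    have hcard : ∀ v, (AA H S v).card = (AA G S v).card := by
      intro v
      by_cases hv : v = u
      · rw [hv, hAG, hAH]
      · have := AA_sum_eq (h.hc v hv) S D h.hG h.hH h.hSG h.hSH (fun _ => 1)
        simp only [Finset.sum_const, nsmul_eq_mul, mul_one] at this
        omega
    have w1 := AA_swapS G S (fun x => (degR G r x : ℤ))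
    have w2 := AA_swapS H S (fun x => (degR H r x : ℤ))
    rw [← Finset.add_sum_erase _ _ hu] at w1 w2
    rw [← Finset.add_sum_erase _ (fun x => ((AA G S x).card : ℤ) * (degR G r x : ℤ)) hu] at w1
    rw [← Finset.add_sum_erase _ (fun x => ((AA H S x).card : ℤ) * (degR H r x : ℤ)) hu] at w2
    rw [Finset.sum_congr rfl hp, Finset.sum_const, hAG, nsmul_eq_mul] at w1
    rw [Finset.sum_congr rfl hq, Finset.sum_const, hAH, nsmul_eq_mul] at w2
    have w3 : ∑ v ∈ S.erase u, ∑ x ∈ AA G S v, (degR G r x : ℤ) = ∑ v ∈ S.erase u, ∑ x ∈ AA H S v, (degR H r x : ℤ) :=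
      Finset.sum_congr rfl (fun v hv => AA_sum_eq (h.hc v (Finset.ne_of_mem_erase hv)) S D h.hG h.hH h.hSG h.hSH (fun f => (f r : ℤ)))
    have w4 : ∑ x ∈ S.erase u, ((AA H S x).card : ℤ) * (degR H r x : ℤ)
        = ∑ x ∈ S.erase u, ((AA G S x).card : ℤ) * (degR G r x : ℤ) + (∑ x ∈ S.erase u, ((AA G S x).card : ℤ)) * δ := by
      rw [Finset.sum_mul, ← Finset.sum_add_distrib]
      apply Finset.sum_congr rfl
      intro x hx
      rw [hcard, card_kappa_rel (h.hc x (Finset.ne_of_mem_erase hx)) r, ← hδ]; ring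
    have w5 := Finset.add_sum_erase S (fun x => ((AA G S x).card : ℤ)) hu
    simp only [hAG] at w5
    have w6 : δ * (∑ x ∈ S, ((AA G S x).card : ℤ) - 2 * S.card) = 0 := by
      rw [← w5]
      push_cast at w1 w2 ⊢
      linarith
    have w7 : ∑ x ∈ S, ((AA G S x).card : ℤ) = ∑ x ∈ S, (2:ℤ) := by
      rcases mul_eq_zero.1 w6 with h | h
      · exact (hδ0 h).elim
      · rw [Finset.sum_const, nsmul_eq_mul]; linarith
    have hfull : ∀ v ∈ S, (AA G S v).card = 2 := by
      have := (Finset.sum_eq_sum_iff_of_le (s := S) (f := fun x => ((AA G S x).card : ℤ)) (g := fun _ => (2:ℤ))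
        (fun x hx => by have := card_AA_le (S := S) (h.NG x hx); exact_mod_cast this)).1 w7
      intro v hv
      exact_mod_cast this v hv
    have hfull' : ∀ v ∈ S, (AA H S v).card = 2 := fun v hv => by rw [hcard, hfull v hv]
    apply hfin
    · rw [← hpa, cycle_eq h hfull hu ha'.2.1 ha'.2.2 r]
    · rw [← hqb, cycle_eq h.symm hfull' hu hb'.2.1 hb'.2.2 r]
  · have hN3 : 3 ≤ N := by omega
    let F : ℤ → ℤ := fun t => if ∃ j : ℕ, t = p - j * δ then 1 else 0
    have hF : ∀ t, F t = F (t + δ) + (if t = p then 1 else 0) := by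
      intro t
      simp only [F]
      by_cases htp : t = p
      · rw [if_pos ⟨0, by simp [htp]⟩, if_neg, if_pos htp]; · rfl
        rintro ⟨j, hj⟩
        have : ((j:ℤ) + 1) * δ = 0 := by rw [htp] at hj; linarith
        rcases mul_eq_zero.1 this with h | h
        · omega
        · exact hδ0 h
      · rw [if_neg htp, add_zero]
        congr 1
        rw [eq_iff_iff]
        constructor
        · rintro ⟨j, hj⟩
          cases j with
          | zero => simp at hj; exact (htp hj).elim
          | succ j => exact ⟨j, by rw [hj]; push_cast; ring⟩
        · rintro ⟨j, hj⟩
          exact ⟨j+1, by push_cast; linarith⟩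
    have F0 : ∀ t, 0 ≤ F t ∧ F t ≤ 1 := by
      intro t; simp only [F]; split_ifs <;> simp
    have e1 := E1 F
    have t1 := T1 F
    have s1 : ∑ x ∈ S, F (degR G r x) = ∑ x ∈ S, F (degR G r x + δ) + (S.filter (fun x => (degR G r x : ℤ) = p)).card := by
      rw [Finset.sum_congr rfl (fun x _ => hF (degR G r x)), Finset.sum_add_distrib,
        Finset.sum_boole (fun x => (degR G r x : ℤ) = p) S]
    have hle : N ≤ (S.filter (fun x => (degR G r x : ℤ) = p)).card := by
      rw [← hAG]
      apply Finset.card_le_card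
      intro x hx
      exact Finset.mem_filter.2 ⟨AA_subset _ _ _ hx, hp x hx⟩
    have f1 := F0 p
    have f2 := F0 q
    have f3 := F0 (degR H r u)
    have f4 := F0 (degR G r u + δ)
    omega

/-- arithmetic-progression lemma -/
lemma ap_lemma {P : Type*} [AddCommGroup P] [IsAddTorsionFree P] (δ x : P) (hδ : δ ≠ 0) :
    ∀ (n : ℕ) (g : Multiset P) (y : P), Multiset.card g = n → x ::ₘ g = y ::ₘ g.map (fun t => t + δ) →
      x ::ₘ g = (Multiset.range (n+1)).map (fun i => y + i • δ) := by
  intro n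
  induction n with
  | zero =>
    intro g y hg h
    rw [Multiset.card_eq_zero] at hg
    subst hg
    simp at h
    simp [h]
  | succ n ih =>
    intro g y hg h
    by_cases hxy : x = y
    · subst hxy
      have h1 := (Multiset.cons_inj_right x).1 h
      have h2 := congrArg Multiset.sum h1
      rw [Multiset.sum_map_add] at h2
      simp [hg] at h2
      rw [← succ_nsmul'] at h2
      exact (hδ ((nsmul_eq_zero_iff_right (Nat.succ_ne_zero n)).1 h2)).elim
    · have hy : y ∈ x ::ₘ g := by rw [h]; simp
      rcases Multiset.mem_cons.1 hy with hy | hy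
      · exact (hxy hy.symm).elim
      · obtain ⟨g', rfl⟩ := Multiset.exists_cons_of_mem hy
        rw [Multiset.cons_swap, Multiset.map_cons, Multiset.cons_inj_right] at h
        have := ih g' (y + δ) (by simpa using hg) h
        rw [Multiset.cons_swap, this]
        have hr : Multiset.range (n+1+1) = 0 ::ₘ (Multiset.range (n+1)).map Nat.succ := by
          change ((List.range (n+1+1) : List ℕ) : Multiset ℕ) = _
          rw [List.range_succ_eq_map]; rfl
        rw [hr, Multiset.map_cons, Multiset.map_map, zero_smul, add_zero]
        congr 1
        apply Multiset.map_congr rfl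
        intro i _
        simp only [Function.comp, Nat.succ_eq_add_one, add_smul, one_smul]
        abel

end mainarg2


section final
open Classical
variable {V : Type*} [Fintype V]

lemma case_eq_aux {G H : SimpleGraph V} {u : V} {S : Finset V} {D N : ℕ} (h : Setup G H u S D N)
    (hu : u ∈ S) (r r' : ℕ) (hrr : r' ≠ r) (hr : kappa G r ≠ kappa H r)
    (heq : S.val.map (fun v => ((degR G r v : ℤ), (degR G r' v : ℤ)))
      = S.val.map (fun v => ((degR H r v : ℤ), (degR H r' v : ℤ)))) :
    S.val.map (fun v => ((degR G r v : ℤ), (degR G r' v : ℤ)))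
      = (Multiset.range S.card).map
        (fun i : ℕ => ((degR H r u : ℤ) + i * ((kappa H r : ℤ) - kappa G r), (degR H r' u : ℤ))) := by
  obtain ⟨δ, hδ⟩ : ∃ δ : ℤ, δ = (kappa H r : ℤ) - kappa G r := ⟨_, rfl⟩
  obtain ⟨δ', hδ'⟩ : ∃ δ' : ℤ, δ' = (kappa H r' : ℤ) - kappa G r' := ⟨_, rfl⟩
  have hδ0 : δ ≠ 0 := by omega
  have hS : S.val = u ::ₘ (S.erase u).val := by
    rw [Finset.erase_val, Multiset.cons_erase hu]
  have hcard : Multiset.card (S.erase u).val + 1 = S.card := by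
    rw [Finset.card, hS, Multiset.card_cons]
  have hH : (S.erase u).val.map (fun v => ((degR H r v : ℤ), (degR H r' v : ℤ)))
      = ((S.erase u).val.map (fun v => ((degR G r v : ℤ), (degR G r' v : ℤ)))).map (fun t => t + (δ, δ')) := by
    rw [Multiset.map_map]
    apply Multiset.map_congr rfl
    intro v hv
    have hvu : v ≠ u := Finset.ne_of_mem_erase (s := S) hv
    simp only [Function.comp, Prod.mk_add_mk]
    rw [card_kappa_rel (h.hc v hvu) r, card_kappa_rel (h.hc v hvu) r', hδ, hδ']
  have heq' := heq
  rw [hS, Multiset.map_cons, Multiset.map_cons, hH] at heq'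
  have hap := ap_lemma (δ, δ') ((degR G r u : ℤ), (degR G r' u : ℤ)) (by simp [hδ0])
    _ _ _ rfl heq'
  have hsum := congrArg Multiset.sum heq'
  rw [Multiset.sum_cons, Multiset.sum_cons, Multiset.sum_map_add] at hsum
  simp only [Multiset.map_id', Multiset.map_const', Multiset.sum_replicate, Multiset.card_map] at hsum hap
  have hx : ((degR G r u : ℤ), (degR G r' u : ℤ)) = ((degR H r u : ℤ), (degR H r' u : ℤ))
      + Multiset.card (S.erase u).val • (δ, δ') := by
    have := add_right_cancel (b := (Multiset.map (fun v => ((degR G r v : ℤ), (degR G r' v : ℤ))) (S.erase u).val).sum)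
      (hsum.trans (by abel : _ = (((degR H r u : ℤ), (degR H r' u : ℤ))
        + Multiset.card (S.erase u).val • (δ, δ')) + (Multiset.map (fun v => ((degR G r v : ℤ), (degR G r' v : ℤ))) (S.erase u).val).sum))
    exact this
  rw [hcard] at hap
  have hx1 : (degR G r u : ℤ) = degR H r u + Multiset.card (S.erase u).val * δ := by
    have := congrArg Prod.fst hx
    simpa using this
  have hx2 : (degR G r' u : ℤ) = degR H r' u + Multiset.card (S.erase u).val * δ' := by
    have := congrArg Prod.snd hx
    simpa using this
  have m1 := missing_rel h.hc r
  have m2 := missing_rel h.hc r'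
  rw [← hδ] at m1
  rw [← hδ'] at m2
  have l1 : (Multiset.card (S.erase u).val : ℤ) = (Fintype.card V : ℤ) - r - 1 := by
    apply mul_right_cancel₀ hδ0
    linarith
  have hδ'0 : δ' = 0 := by
    by_contra hne
    have l2 : (Multiset.card (S.erase u).val : ℤ) = (Fintype.card V : ℤ) - r' - 1 := by
      apply mul_right_cancel₀ hne
      linarith
    omega
  refine Eq.trans (by rw [hS, Multiset.map_cons]) (hap.trans ?_)
  apply Multiset.map_congr rfl
  intro i _
  rw [hδ'0, ← hδ]
  simp

lemma main_general {G H : SimpleGraph V} {u : V} {S : Finset V} {D N : ℕ} (h : Setup G H u S D N)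
    (r : ℕ) (hr : kappa G r ≠ kappa H r) :
    (∀ r', r' ≠ r → ∀ v ∈ S, ∀ v' ∈ S, degR G r' v = degR G r' v') ∧
    ∃ a d : ℕ, S.val.map (fun v => degR G r v) = (Multiset.range S.card).map (fun i => a + i * d) := by
  by_cases hN : N = 0
  · subst hN
    have hconst : ∀ s, ∀ v ∈ S, ∀ v' ∈ S, degR G s v = degR G s v' := by
      have hdom : ∀ v ∈ S, ∀ y, y ≠ v → G.Adj v y := by
        intro v hv y hy
        by_contra hna
        have h1 := compl_deg G v
        have h2 := h.NG v hv
        have h0 : (Finset.univ.filter (fun y => y ≠ v ∧ ¬ G.Adj v y)).card = 0 := by omega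
        rw [Finset.card_eq_zero, Finset.filter_eq_empty_iff] at h0
        exact h0 (Finset.mem_univ y) ⟨hy, hna⟩
      intro s
      induction s with
      | zero => intros; rw [degR_zero, degR_zero]
      | succ s ih =>
        intro v hv v' hv'
        have e1 := degR_dom G s v (hdom v hv)
        have e2 := degR_dom G s v' (hdom v' hv')
        have := ih v hv v' hv'
        omega
    refine ⟨fun r' _ => hconst r', ?_⟩
    obtain ⟨v0, hv0⟩ := h.hne
    refine ⟨degR G r v0, 0, ?_⟩
    rw [Multiset.map_congr (g := fun _ => degR G r v0) rfl (fun v hv => hconst r v hv v0 hv0)]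
    simp
  · by_cases hu : u ∈ S
    · have key : ∀ r', S.val.map (fun v => ((degR G r v : ℤ), (degR G r' v : ℤ)))
          = S.val.map (fun v => ((degR H r v : ℤ), (degR H r' v : ℤ))) := by
        intro r'
        by_contra hne
        have hK : ∀ F : ℤ × ℤ → ℤ, _ := fun F => h.K (fun f => F ((f r : ℤ), (f r' : ℤ)))
        obtain ⟨c1, p, hp⟩ := dich S (AA G S u) (AA H S u) N _ _ hK (card_AA_le (h.NG u hu)) hne
        obtain ⟨c2, q, hq⟩ := dich S (AA H S u) (AA G S u) N _ _ (fun F => (hK F).symm)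
          (card_AA_le (h.symm.NG u hu)) (Ne.symm hne)
        exact case_neq h hu (by omega) r hr c1 c2 p.1 q.1
          (fun x hx => congrArg Prod.fst (hp x hx)) (fun x hx => congrArg Prod.fst (hq x hx))
      constructor
      · intro r' hr'
        have e := case_eq_aux h hu r r' hr' hr (key r')
        have hall : ∀ v ∈ S, (degR G r' v : ℤ) = degR H r' u := by
          intro v hv
          have hm : ((degR G r v : ℤ), (degR G r' v : ℤ)) ∈ S.val.map (fun v => ((degR G r v : ℤ), (degR G r' v : ℤ))) :=
            Multiset.mem_map_of_mem (fun v => ((degR G r v : ℤ), (degR G r' v : ℤ))) hv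
          rw [e, Multiset.mem_map] at hm
          obtain ⟨i, _, hi⟩ := hm
          exact (congrArg Prod.snd hi).symm
        intro v hv v' hv'
        have h1 := hall v hv
        have h2 := hall v' hv'
        omega
      · have fin : ∀ (a : ℕ) (d : ℤ), 0 ≤ d → S.val.map (fun v => (degR G r v : ℤ))
            = (Multiset.range S.card).map (fun i : ℕ => (a : ℤ) + i * d) →
            ∃ a d : ℕ, S.val.map (fun v => degR G r v) = (Multiset.range S.card).map (fun i => a + i * d) := by
          intro a d hd he
          refine ⟨a, d.toNat, ?_⟩
          apply Multiset.map_injective (f := fun n : ℕ => (n : ℤ)) Nat.cast_injective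
          rw [Multiset.map_map, Multiset.map_map]
          refine he.trans ?_
          apply Multiset.map_congr rfl
          intro i _
          simp [hd]
        rcases lt_or_gt_of_ne hr with hlt | hgt
        · have e := congrArg (Multiset.map Prod.fst) (case_eq_aux h hu r (r+1) (by omega) hr (key (r+1)))
          rw [Multiset.map_map, Multiset.map_map] at e
          exact fin (degR H r u) ((kappa H r : ℤ) - kappa G r) (by omega) e
        · have e := congrArg (Multiset.map Prod.fst)
            (case_eq_aux h.symm hu r (r+1) (by omega) hr.symm (key (r+1)).symm)
          rw [← key (r+1), Multiset.map_map, Multiset.map_map] at e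
          exact fin (degR G r u) ((kappa G r : ℤ) - kappa H r) (by omega) e
    · exact (case_out h hu (by omega) r hr).elim

end final

theorem arithmetic_progression_of_ne {n : ℕ} (hn : 7 ≤ n)
    (G H : SimpleGraph (Fin n)) (hshare : ShareCards G H)
    (r : ℕ) (hr : 1 ≤ r) (hk : kappa G r ≠ kappa H r) :
    (∀ r' : ℕ, 1 ≤ r' → r' ≠ r → ∀ v v' : Fin n,
      deg G v = maxDeg G → deg G v' = maxDeg G → degR G r' v = degR G r' v') ∧
    (∃ a d : ℕ,
      (Finset.univ.filter (fun v : Fin n => deg G v = maxDeg G)).val.map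
          (fun v => degR G r v)
        = (Multiset.range (numMaxDeg G)).map (fun i => a + i * d)) := by
  obtain ⟨u, w, π, hπ⟩ := hshare
  let σ : Equiv.Perm (Fin n) := π.extendSubtype
  have hσ : ∀ (x : Fin n) (hx : x ≠ u), σ x = (π ⟨x, hx⟩).1 := fun x hx =>
    π.extendSubtype_apply_of_mem x hx
  let H' : SimpleGraph (Fin n) := H.comap σ
  have iso : H' ≃g H := ⟨σ, Iff.rfl⟩
  have hc : ∀ v, v ≠ u → Nonempty (gcard G v ≃g gcard H' v) := by
    intro v hv
    obtain ⟨φ⟩ := hπ ⟨v, hv⟩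
    rw [← hσ v hv] at φ
    have ψ : gcard H' v ≃g gcard H (σ v) :=
      ⟨σ.subtypeEquiv (fun x => by simp), Iff.rfl⟩
    exact ⟨φ.trans ψ.symm⟩
  have hdeg := deg_same (by simpa using hn) hc
  have hle : ∀ x, deg G x ≤ maxDeg G := fun x => Finset.le_sup (f := fun v => deg G v) (Finset.mem_univ x)
  obtain ⟨x0, -, hx0⟩ := Finset.exists_mem_eq_sup (Finset.univ : Finset (Fin n)) ⟨u, Finset.mem_univ u⟩ (fun v => deg G v)
  have hlt := deg_lt G x0
  have hx0' : deg G x0 = maxDeg G := hx0.symm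
  have hset : Setup G H' u (Finset.univ.filter (fun v : Fin n => deg G v = maxDeg G)) (maxDeg G)
      (Fintype.card (Fin n) - 1 - maxDeg G) :=
    ⟨hc, hle, fun x => by rw [hdeg]; exact hle x, by simp, by simp [hdeg], by omega, ⟨x0, by simpa using hx0'⟩⟩
  have hk' : kappa G r ≠ kappa H' r := by rw [kappa_iso iso]; exact hk
  obtain ⟨h1, h2⟩ := main_general hset r hk'
  refine ⟨?_, h2⟩
  intro r' _ hr' v v' hv hv'
  exact h1 r' hr' v (by simpa using hv) v' (by simpa using hv')
end
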